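/- arXiv:2507.20416 — 4 statements merged into one kernel-verified Lean document; each statement's English description precedes it below -/
import Mathlib

section
/- Let α, β, γ be irrational numbers such that the triple (α, β, γ) is pairwise independent, with continued fraction convergent denominators (q_m), (h_s), (r_l) respectively. Suppose that for some indices m, s, l the following equalities hold: q_m = h_s, q_{m+1} = r_l, r_{l+1} = h_{s+1}, q_{m+2} = h_{s+2}, q_{m+3} = r_{l+2}, and r_{l+3} = h_{s+3}. Then ψ_β(t) > ψ_α(t) for all t ∈ [h_{s+1}, h_{s+2}). -/
/-- Distance from `x` to the nearest integer. -/
noncomputable def distToInt (x : ℝ) : ℝ := |x - round x|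

/-- The irrationality measure function `ψ_α(t) = min_{1 ≤ q ≤ t} ‖qα‖`. -/
noncomputable def psi (α : ℝ) (t : ℝ) : ℝ :=
  sInf ((fun q : ℤ => distToInt ((q : ℝ) * α)) '' {q : ℤ | 1 ≤ q ∧ (q : ℝ) ≤ t})

/-- An `n`-tuple is pairwise independent if eventually all the values
`ψ_{α_i}(t)` are pairwise distinct. -/
def PairwiseIndependent {n : ℕ} (α : Fin n → ℝ) : Prop :=
  ∃ T : ℝ, 0 ≤ T ∧ ∀ t : ℝ, T ≤ t → ∀ i j : Fin n, i ≠ j → psi (α i) t ≠ psi (α j) t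

/-- `v : Fin n → Fin n` is the order vector of `α` at time `t`:
`ψ_{α_{v 0}}(t) > ψ_{α_{v 1}}(t) > … > ψ_{α_{v (n-1)}}(t)`. -/
def IsOrderVec {n : ℕ} (α : Fin n → ℝ) (t : ℝ) (v : Fin n → Fin n) : Prop :=
  Function.Bijective v ∧
    ∀ p q : Fin n, p < q → psi (α (v p)) t > psi (α (v q)) t

/-- The order vector `v` occurs at arbitrarily large times. -/
def OccursInfinitely {n : ℕ} (α : Fin n → ℝ) (v : Fin n → Fin n) : Prop :=
  ∀ T : ℝ, ∃ t : ℝ, T < t ∧ IsOrderVec α t v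

/-- `k(α)`: the number of distinct order vectors occurring for arbitrarily large `t`. -/
noncomputable def kAlpha {n : ℕ} (α : Fin n → ℝ) : ℕ :=
  Nat.card {v : Fin n → Fin n | OccursInfinitely α v}

/-- The relative order of the functions `ψ_{α_i}` is the same at times `t` and `t'`
(i.e. the order vectors coincide). -/
def SameOrder {n : ℕ} (α : Fin n → ℝ) (t t' : ℝ) : Prop :=
  ∀ i j : Fin n, (psi (α i) t < psi (α j) t ↔ psi (α i) t' < psi (α j) t')

/-- `ts` is a sequence of moments of permutation changes:
`ts (i+1) = min { t > ts i : v_α(t) ≠ v_α(ts i) }`. -/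
def IsChangeSeq {n : ℕ} (α : Fin n → ℝ) (ts : ℕ → ℝ) : Prop :=
  ∀ i : ℕ, IsLeast {t : ℝ | ts i < t ∧ ¬ SameOrder α (ts i) t} (ts (i + 1))

/-- The set of positions `(j,l)`, `1 ≤ j ≤ l ≤ k` (here `0`-based). -/
def PairIdx (k : ℕ) := {p : Fin k × Fin k // p.1 ≤ p.2}

/-- Construct a position from `0`-based indices `j ≤ l < k`. -/
def mkPos {k : ℕ} (j l : ℕ) (hj : j ≤ l) (hl : l < k) : PairIdx k :=
  ⟨(⟨j, lt_of_le_of_lt hj hl⟩, ⟨l, hl⟩), Fin.mk_le_mk.mpr hj⟩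

/-- The position permutation underlying `π`: one has `π(u) = u ∘ tau`.
In `1`-based notation: `tau (i,i) = (i+1,i+1)` for `i < k`, `tau (k,k) = (1,1)`,
`tau (i,k) = (1,i+1)` for `i < k`, and `tau (i,j) = (i+1,j+1)` otherwise. -/
def tau {k : ℕ} (p : PairIdx k) : PairIdx k :=
  if h2 : p.1.2.val = k - 1 then
    if h1 : p.1.1.val = k - 1 then
      ⟨(⟨0, by have := p.1.2.isLt; omega⟩, ⟨0, by have := p.1.2.isLt; omega⟩), le_refl _⟩
    else
      ⟨(⟨0, by have := p.1.2.isLt; omega⟩,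
        ⟨p.1.1.val + 1, by have := p.1.1.isLt; omega⟩),
       Fin.mk_le_mk.mpr (by omega)⟩
  else
    ⟨(⟨p.1.1.val + 1, by have h := p.1.2.isLt; have h' : p.1.1.val ≤ p.1.2.val := p.2; omega⟩,
      ⟨p.1.2.val + 1, by have h := p.1.2.isLt; omega⟩),
     Fin.mk_le_mk.mpr (by have h' : p.1.1.val ≤ p.1.2.val := p.2; omega)⟩

/-- The action of `π` on vectors indexed by positions: `π(u) = u ∘ tau`. -/
def piMap {k : ℕ} {X : Type*} (u : PairIdx k → X) : PairIdx k → X :=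
  fun p => u (tau p)

/-- The (`0`-based) linear position of the pair `(j,l)` in the special enumeration
`u_{1,1}, u_{1,k}, u_{1,k-1}, …, u_{1,2}, u_{2,2}, u_{2,k}, …, u_{k,k}`. -/
def posIdx {k : ℕ} (p : PairIdx k) : ℕ :=
  (p.1.1.val * k - p.1.1.val * (p.1.1.val - 1) / 2) +
    (if p.1.2.val = p.1.1.val then 0 else k - p.1.2.val)

/-- `v : PairIdx k → Fin n` is the order vector of `α` at time `t`, written in the
special pair enumeration: the function at position `p` is larger than the one at
position `q` whenever `p` precedes `q` in the enumeration. -/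
def IsOrderVecP {n k : ℕ} (α : Fin n → ℝ) (t : ℝ) (v : PairIdx k → Fin n) : Prop :=
  Function.Bijective v ∧
    ∀ p q : PairIdx k, posIdx p < posIdx q → psi (α (v p)) t > psi (α (v q)) t

/-- Denominator `q_m` of the `m`-th convergent of the continued fraction of `α`. -/
noncomputable def cfDen (α : ℝ) (m : ℕ) : ℝ := (GenContFract.of α).dens m

/-- The orbit equivalence relation of the map `tau` on positions. -/
def orbitSetoid (k : ℕ) : Setoid (PairIdx k) where
  r p q := ∃ a b : ℕ, (fun x : PairIdx k => tau x)^[a] p = (fun x : PairIdx k => tau x)^[b] q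
  iseqv := by
    constructor
    · exact fun p => ⟨0, 0, rfl⟩
    · rintro p q ⟨a, b, h⟩; exact ⟨b, a, h.symm⟩
    · rintro p q r ⟨a, b, h1⟩ ⟨c, d, h2⟩
      refine ⟨c + a, b + d, ?_⟩
      rw [Function.iterate_add_apply, h1, ← Function.iterate_add_apply,
        Nat.add_comm c b, Function.iterate_add_apply, h2, ← Function.iterate_add_apply]

/-- `a`, `p`, `q` are the partial quotients (from index two on) and the numerators and
denominators of the convergents of the irrational number `α`. -/
structure IsConvergentSeq (α : ℝ) (a p q : ℕ → ℤ) : Prop where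
  cfDen_eq : ∀ n, cfDen α n = q n
  one_le_quot : ∀ n, 1 ≤ a n
  den_pos : ∀ n, 0 < q n
  num_rec : ∀ n, p (n + 2) = a n * p (n + 1) + p n
  den_rec : ∀ n, q (n + 2) = a n * q (n + 1) + q n
  det : ∀ n, q n * p (n + 1) - p n * q (n + 1) = (-1) ^ n
  err_pos : ∀ n, 0 < (-1 : ℝ) ^ n * (q n * α - p n)
  err_lt : ∀ n, (-1 : ℝ) ^ (n + 1) * (q (n + 1) * α - p (n + 1)) < (-1 : ℝ) ^ n * (q n * α - p n)

/-- The sequence of fractional parts in the continued fraction algorithm. -/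
noncomputable def gaussIter (α : ℝ) : ℕ → ℝ
  | 0 => Int.fract α
  | n + 1 => Int.fract (gaussIter α n)⁻¹

theorem Irrational.fract {x : ℝ} (hx : Irrational x) : Irrational (Int.fract x) :=
  hx.sub_intCast ⌊x⌋

theorem irrational_gaussIter {α : ℝ} (hα : Irrational α) : ∀ n, Irrational (gaussIter α n)
  | 0 => hα.fract
  | n + 1 => (irrational_gaussIter hα n).inv.fract

theorem gaussIter_pos {α : ℝ} (hα : Irrational α) (n : ℕ) : 0 < gaussIter α n := by
  refine lt_of_le_of_ne ?_ (irrational_gaussIter hα n).ne_zero.symm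
  cases n <;> exact Int.fract_nonneg _

theorem gaussIter_lt_one (α : ℝ) (n : ℕ) : gaussIter α n < 1 := by
  cases n <;> exact Int.fract_lt_one _

theorem stream_eq_gaussIter {α : ℝ} (hα : Irrational α) (n : ℕ) :
    ∃ b : ℤ, GenContFract.IntFractPair.stream α n = some ⟨b, gaussIter α n⟩ := by
  induction n with
  | zero => exact ⟨⌊α⌋, rfl⟩
  | succ n ih =>
    obtain ⟨b, hb⟩ := ih
    exact ⟨⌊(gaussIter α n)⁻¹⌋,
      GenContFract.IntFractPair.stream_succ_of_some hb (gaussIter_pos hα n).ne'⟩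

theorem get?_s_of_irrational {α : ℝ} (hα : Irrational α) (n : ℕ) :
    (GenContFract.of α).s.get? n = some ⟨1, (⌊(gaussIter α n)⁻¹⌋ : ℝ)⟩ := by
  obtain ⟨b, hb⟩ := stream_eq_gaussIter hα n
  exact GenContFract.get?_of_eq_some_of_get?_intFractPair_stream_fr_ne_zero hb
    (gaussIter_pos hα n).ne'

/-- The solution of the continuant recurrence with initial values `x`, `y` and
partial quotients `a`. -/
def continuantSeq (a : ℕ → ℤ) (x y : ℤ) : ℕ → ℤ
  | 0 => x
  | 1 => y
  | n + 2 => a n * continuantSeq a x y (n + 1) + continuantSeq a x y n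

theorem Irrational.exists_isConvergentSeq {α : ℝ} (hα : Irrational α) :
    ∃ a p q : ℕ → ℤ, IsConvergentSeq α a p q := by
  set b : ℕ → ℤ := fun n => ⌊(gaussIter α n)⁻¹⌋
  set a : ℕ → ℤ := fun n => b (n + 1)
  set p := continuantSeq a ⌊α⌋ (b 0 * ⌊α⌋ + 1)
  set q := continuantSeq a 1 (b 0)
  have hb1 (n : ℕ) : 1 ≤ b n :=
    Int.le_floor.2 (by
      simpa using (one_le_inv₀ (gaussIter_pos hα n)).2 (gaussIter_lt_one α n).le)
  have hpos (n : ℕ) : 0 < q n ∧ 0 < q (n + 1) := by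
    induction n with
    | zero => exact ⟨one_pos, hb1 0⟩
    | succ n ih =>
      refine ⟨ih.2, ?_⟩
      change 0 < a n * q (n + 1) + q n
      have := mul_pos (show 0 < a n from hb1 (n + 1)) ih.2
      linarith [ih.1]
  have hden (n : ℕ) : cfDen α n = q n ∧ cfDen α (n + 1) = q (n + 1) := by
    induction n with
    | zero =>
      exact ⟨by simp [cfDen, q, continuantSeq],
        GenContFract.first_den_eq (get?_s_of_irrational hα 0)⟩
    | succ n ih =>
      refine ⟨ih.2, ?_⟩
      rw [cfDen, GenContFract.dens_recurrence (get?_s_of_irrational hα (n + 1)) ih.1 ih.2]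
      simp [q, continuantSeq, a, b]
  have hdet (n : ℕ) : q n * p (n + 1) - p n * q (n + 1) = (-1) ^ n := by
    induction n with
    | zero => simp [p, q, continuantSeq]; ring
    | succ n ih =>
      change q (n + 1) * (a n * p (n + 1) + p n) - p (n + 1) * (a n * q (n + 1) + q n) = _
      rw [pow_succ, ← ih]
      ring
  have hinv (n : ℕ) : gaussIter α n * (b n + gaussIter α (n + 1)) = 1 := by
    rw [show (b n : ℝ) + gaussIter α (n + 1) = (gaussIter α n)⁻¹ from Int.floor_add_fract _]
    exact mul_inv_cancel₀ (gaussIter_pos hα n).ne'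
  have herr (n : ℕ) : 0 < (-1 : ℝ) ^ n * (q n * α - p n) ∧
      (-1 : ℝ) ^ (n + 1) * (q (n + 1) * α - p (n + 1)) =
        gaussIter α (n + 1) * ((-1 : ℝ) ^ n * (q n * α - p n)) := by
    induction n with
    | zero =>
      have h0 : gaussIter α 0 = α - ⌊α⌋ := rfl
      have h1 := hinv 0
      refine ⟨by simpa [p, q, continuantSeq, h0] using gaussIter_pos hα 0, ?_⟩
      simp only [p, q, continuantSeq]
      push_cast
      rw [h0] at h1
      linear_combination -h1
    | succ n ih =>
      refine ⟨ih.2 ▸ mul_pos (gaussIter_pos hα _) ih.1, ?_⟩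
      have hp : (p (n + 2) : ℝ) = b (n + 1) * p (n + 1) + p n := by
        simp [p, continuantSeq, a]
      have hq : (q (n + 2) : ℝ) = b (n + 1) * q (n + 1) + q n := by
        simp [q, continuantSeq, a]
      rw [hp, hq, ih.2]
      have h1 := hinv (n + 1)
      have h2 := ih.2
      rw [pow_succ] at h2 ⊢
      rw [pow_succ]
      linear_combination (-(b (n + 1)) : ℝ) * h2 - (-1) ^ n * (q n * α - p n) * h1
  refine ⟨a, p, q, fun n => (hden n).1, fun n => hb1 (n + 1), fun n => (hpos n).1,
    fun _ => rfl, fun _ => rfl, hdet, fun n => (herr n).1, fun n => ?_⟩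
  rw [(herr n).2]
  exact mul_lt_of_lt_one_left (herr n).1 (gaussIter_lt_one α _)

namespace IsConvergentSeq

variable {α : ℝ} {a p q : ℕ → ℤ}

theorem isCoprime (h : IsConvergentSeq α a p q) (n : ℕ) : IsCoprime (q n) (q (n + 1)) := by
  refine ⟨(-1) ^ n * p (n + 1), -((-1) ^ n * p n), ?_⟩
  have h1 : ((-1) ^ n * (-1) ^ n : ℤ) = 1 := by rw [← mul_pow]; simp
  linear_combination (-1) ^ n * h.det n + h1

theorem err_mul_add_err_mul (h : IsConvergentSeq α a p q) (n : ℕ) :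
    (-1 : ℝ) ^ n * (q n * α - p n) * q (n + 1) +
      (-1 : ℝ) ^ (n + 1) * (q (n + 1) * α - p (n + 1)) * q n = 1 := by
  have h1 : ((-1) ^ n * (-1) ^ n : ℝ) = 1 := by rw [← mul_pow]; simp
  have h2 : (q n * p (n + 1) - p n * q (n + 1) : ℝ) = (-1) ^ n := mod_cast h.det n
  linear_combination (-1) ^ n * h2 + h1

theorem err_rec (h : IsConvergentSeq α a p q) (n : ℕ) :
    (-1 : ℝ) ^ n * (q n * α - p n) =
      a n * ((-1 : ℝ) ^ (n + 1) * (q (n + 1) * α - p (n + 1))) +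
        (-1 : ℝ) ^ (n + 2) * (q (n + 2) * α - p (n + 2)) := by
  rw [h.num_rec, h.den_rec]
  push_cast
  ring

/-- Convergents are best approximations of the second kind. -/
theorem err_le_abs_sub (h : IsConvergentSeq α a p q) {n : ℕ} {k : ℤ} (hk : 0 < k)
    (hkn : k < q (n + 1)) (j : ℤ) :
    (-1 : ℝ) ^ n * (q n * α - p n) ≤ |k * α - j| := by
  have hs : ((-1) ^ n * (-1) ^ n : ℤ) = 1 := by rw [← mul_pow]; simp
  have hdet := h.det n
  obtain ⟨x, hx⟩ : ∃ x, x = (-1) ^ n * (k * p (n + 1) - j * q (n + 1)) := ⟨_, rfl⟩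
  obtain ⟨y, hy⟩ : ∃ y, y = (-1) ^ n * (j * q n - k * p n) := ⟨_, rfl⟩
  have hkxy : k = x * q n + y * q (n + 1) := by
    rw [hx, hy]; linear_combination (-(-1) ^ n * k) * hdet - k * hs
  have hjxy : j = x * p n + y * p (n + 1) := by
    rw [hx, hy]; linear_combination (-(-1) ^ n * j) * hdet - j * hs
  have hq := h.den_pos n
  have hq' := h.den_pos (n + 1)
  have he := h.err_pos n
  have he' := h.err_pos (n + 1)
  set e := (-1 : ℝ) ^ n * (q n * α - p n) with he_def
  set e' := (-1 : ℝ) ^ (n + 1) * (q (n + 1) * α - p (n + 1)) with he'_def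
  have habs : |(k : ℝ) * α - j| = |x * e - y * e'| := by
    have : x * e - y * e' = (-1) ^ n * (k * α - j) := by
      rw [hkxy, hjxy, he_def, he'_def]; push_cast; ring
    rw [this, abs_mul, abs_neg_one_pow, one_mul]
  rw [habs]
  rcases le_or_gt y 0 with hy0 | hy0
  · have hx1 : 1 ≤ x := by
      by_contra! hx0
      nlinarith
    refine le_trans ?_ (le_abs_self _)
    have hx1' : (1 : ℝ) ≤ x := mod_cast hx1
    have hy0' : (y : ℝ) ≤ 0 := mod_cast hy0
    nlinarith
  · have hx1 : x ≤ -1 := by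
      by_contra! hx0
      nlinarith
    refine le_trans ?_ (neg_le_abs _)
    have hx1' : (x : ℝ) ≤ -1 := mod_cast hx1
    have hy0' : (0 : ℝ) < y := mod_cast hy0
    nlinarith

theorem err_le_psi (h : IsConvergentSeq α a p q) {n : ℕ} {t : ℝ} (ht : 1 ≤ t)
    (htn : t < q (n + 1)) : (-1 : ℝ) ^ n * (q n * α - p n) ≤ psi α t := by
  refine le_csInf ⟨_, 1, ⟨le_rfl, by simpa using ht⟩, rfl⟩ ?_
  rintro _ ⟨k, ⟨hk, hkt⟩, rfl⟩
  exact h.err_le_abs_sub (by lia) (by exact_mod_cast hkt.trans_lt htn) _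

theorem psi_le_err (h : IsConvergentSeq α a p q) {n : ℕ} {t : ℝ} (ht : (q n : ℝ) ≤ t) :
    psi α t ≤ (-1 : ℝ) ^ n * (q n * α - p n) := by
  have hbdd : BddBelow ((fun k : ℤ => distToInt (k * α)) '' {k : ℤ | 1 ≤ k ∧ (k : ℝ) ≤ t}) := by
    refine ⟨0, ?_⟩
    rintro _ ⟨k, -, rfl⟩
    exact abs_nonneg _
  calc psi α t ≤ distToInt (q n * α) := csInf_le hbdd ⟨q n, ⟨h.den_pos n, ht⟩, rfl⟩
    _ ≤ |q n * α - p n| := round_le _ _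
    _ = _ := by rw [← abs_of_pos (h.err_pos n), abs_mul, abs_neg_one_pow, one_mul]

theorem err_mul_lt (h : IsConvergentSeq α a p q) (n : ℕ) :
    (-1 : ℝ) ^ n * (q n * α - p n) * (q (n + 1) * (a n + 1) + q n) < a n + 1 := by
  have h1 := h.err_mul_add_err_mul n
  have h2 := h.err_rec n
  have h3 := h.err_lt (n + 1)
  have hq : (0 : ℝ) < q n := mod_cast h.den_pos n
  have ha : (1 : ℝ) ≤ a n := mod_cast h.one_le_quot n
  nlinarith

theorem lt_err_mul (h : IsConvergentSeq α a p q) (n : ℕ) :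
    a n < (-1 : ℝ) ^ n * (q n * α - p n) * (q (n + 1) * a n + q n) := by
  have h1 := h.err_mul_add_err_mul n
  have h2 := h.err_rec n
  have h3 := h.err_pos (n + 2)
  have hq : (0 : ℝ) < q n := mod_cast h.den_pos n
  linear_combination mul_pos h3 hq - (a n : ℝ) * h1 - (q n : ℝ) * h2

end IsConvergentSeq

/-- Coprimality of consecutive denominators forces the comparison of the partial quotients
`u` and `v` of two interlacing continuant recurrences. -/
theorem mul_add_one_lt_mul_of_interlacing {A B C D E x y z u v w : ℤ} (hA : 0 < A) (hB : 0 < B)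
    (hC : 0 < C) (hD : 0 < D) (hE : 0 < E) (hx : 0 < x) (hu : 0 < u) (hv : 0 < v)
    (hBC : IsCoprime B C) (hCD : IsCoprime C D) (hDE : IsCoprime D E)
    (h1 : D = x * B + A) (h2 : D = y * C + A) (h3 : E = u * D + B) (h4 : E = z * C + B)
    (h5 : v * D + C = w * E + C) : C * (u + 1) < B * v := by
  have hCx : C ≤ x := Int.le_of_dvd hx
    (hBC.symm.dvd_of_dvd_mul_right ⟨y, by linarith⟩)
  have hCu : C ≤ u := Int.le_of_dvd hu
    (hCD.dvd_of_dvd_mul_right ⟨z, by linarith⟩)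
  have hEv : E ≤ v := Int.le_of_dvd hv
    (hDE.symm.dvd_of_dvd_mul_right ⟨w, by linarith⟩)
  have hDC : C + 1 ≤ D := by nlinarith
  have hEu : C * (u + 1) < E := by nlinarith
  nlinarith

/-- **Lemma on three functions.** -/
theorem stmt6 (α β γ : ℝ) (hirr : ∀ i, Irrational (![α, β, γ] i))
    (hind : PairwiseIndependent ![α, β, γ]) (m s l : ℕ)
    (e1 : cfDen α m = cfDen β s) (e2 : cfDen α (m + 1) = cfDen γ l)
    (e3 : cfDen γ (l + 1) = cfDen β (s + 1)) (e4 : cfDen α (m + 2) = cfDen β (s + 2))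
    (e5 : cfDen α (m + 3) = cfDen γ (l + 2)) (e6 : cfDen γ (l + 3) = cfDen β (s + 3)) :
    ∀ t : ℝ, cfDen β (s + 1) ≤ t → t < cfDen β (s + 2) → psi β t > psi α t := by
  intro t ht1 ht2
  obtain ⟨a, p, q, hα⟩ := Irrational.exists_isConvergentSeq (α := α) (hirr 0)
  obtain ⟨b, k, h, hβ⟩ := Irrational.exists_isConvergentSeq (α := β) (hirr 1)
  obtain ⟨c, o, r, hγ⟩ := Irrational.exists_isConvergentSeq (α := γ) (hirr 2)
  have hBC_le : cfDen γ l ≤ cfDen γ (l + 1) := GenContFract.of_den_mono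
  rw [e3, ← e2] at hBC_le
  simp only [hα.cfDen_eq, hβ.cfDen_eq, hγ.cfDen_eq] at e1 e2 e3 e4 e5 e6 ht1 ht2 hBC_le
  norm_cast at e1 e2 e3 e4 e5 e6
  have key : h (s + 1) * (a (m + 1) + 1) < q (m + 1) * b (s + 1) := by
    have hBC := hγ.isCoprime l
    have hCD := hβ.isCoprime (s + 1)
    have h2 := hβ.den_rec s
    have h4 := hγ.den_rec l
    have h5 := hγ.den_rec (l + 1)
    rw [← e2, e3] at hBC
    rw [← e4] at hCD h2
    rw [← e1] at h2
    rw [← e5, ← e2, e3] at h4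
    rw [e6, hβ.den_rec (s + 1), ← e5, e3, ← e4] at h5
    exact mul_add_one_lt_mul_of_interlacing (hα.den_pos m) (hα.den_pos (m + 1))
      (hβ.den_pos (s + 1)) (hα.den_pos (m + 2)) (hα.den_pos (m + 3)) (hα.one_le_quot m)
      (hα.one_le_quot (m + 1)) (hβ.one_le_quot (s + 1)) hBC hCD (hα.isCoprime (m + 2))
      (hα.den_rec m) h2 (hα.den_rec (m + 1)) h4 h5
  have hlow := hβ.err_le_psi (n := s + 1)
    ((show (1 : ℝ) ≤ h (s + 1) by exact_mod_cast hβ.den_pos (s + 1)).trans ht1) ht2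
  have hupp := hα.psi_le_err (n := m + 1) (hBC_le.trans ht1)
  refine hupp.trans_lt (lt_of_lt_of_le ?_ hlow)
  have hu := hα.err_mul_lt (m + 1)
  have hv := hβ.lt_err_mul (s + 1)
  have hepos := hα.err_pos (m + 1)
  rw [show h (s + 1 + 1) = q (m + 2) from e4.symm] at hv
  rw [show m + 1 + 1 = m + 2 from rfl] at hu
  generalize (-1 : ℝ) ^ (m + 1) * (q (m + 1) * α - p (m + 1)) = ε at hu hepos ⊢
  generalize (-1 : ℝ) ^ (s + 1) * (h (s + 1) * β - k (s + 1)) = δ at hv ⊢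
  have hC : (0 : ℝ) < h (s + 1) := mod_cast hβ.den_pos (s + 1)
  have hD : (0 : ℝ) < q (m + 2) := mod_cast hα.den_pos (m + 2)
  have ha : (1 : ℝ) ≤ a (m + 1) := mod_cast hα.one_le_quot (m + 1)
  have hb : (1 : ℝ) ≤ b (s + 1) := mod_cast hβ.one_le_quot (s + 1)
  have key' : (h (s + 1) * (a (m + 1) + 1) : ℝ) < q (m + 1) * b (s + 1) := mod_cast key
  generalize (q (m + 1) : ℝ) = B, (h (s + 1) : ℝ) = C, (q (m + 2) : ℝ) = D,
    (a (m + 1) : ℝ) = x, (b (s + 1) : ℝ) = y at *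
  have hpos : 0 < (D * y + C) * (x + 1) := by positivity
  refine lt_of_mul_lt_mul_right ?_ hpos.le
  calc ε * ((D * y + C) * (x + 1)) = ε * (D * (x + 1) * y + C * (x + 1)) := by ring
    _ < ε * (D * (x + 1) * y + B * y) := by gcongr
    _ = ε * (D * (x + 1) + B) * y := by ring
    _ < (x + 1) * y := by gcongr
    _ < (x + 1) * (δ * (D * y + C)) := by gcongr
    _ = δ * ((D * y + C) * (x + 1)) := by ring
end

section
/- Let k ≥ 2 and n = k(k+1)/2. The permutation π, viewed as a permutation of the n positions indexed by pairs (j,l) with 1 ≤ j ≤ l ≤ k, has order exactly k: π iterated k times is the identity, and no smaller positive power of π is the identity. -/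
/-- A position `(j,l)` seen as an unordered pair of residues modulo `k`. -/
def residuePair {k : ℕ} (p : PairIdx k) : Sym2 (ZMod k) :=
  s((p.1.1.val : ZMod k), (p.1.2.val : ZMod k))

theorem natCast_zmod_inj_of_lt {k a b : ℕ} (ha : a < k) (hb : b < k)
    (h : (a : ZMod k) = b) : a = b :=
  ((ZMod.natCast_eq_natCast_iff a b k).1 h).eq_of_lt_of_lt ha hb

theorem residuePair_injective {k : ℕ} :
    Function.Injective (residuePair : PairIdx k → Sym2 (ZMod k)) := by
  rintro ⟨⟨a, b⟩, hab⟩ ⟨⟨c, d⟩, hcd⟩ h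
  have hab' : a ≤ b := hab
  have hcd' : c ≤ d := hcd
  apply Subtype.ext
  rcases Sym2.eq_iff.1 h with ⟨h₁, h₂⟩ | ⟨h₁, h₂⟩ <;>
    have h₃ := natCast_zmod_inj_of_lt (Fin.isLt _) (Fin.isLt _) h₁ <;>
    have h₄ := natCast_zmod_inj_of_lt (Fin.isLt _) (Fin.isLt _) h₂ <;>
    refine Prod.ext (Fin.ext ?_) (Fin.ext ?_) <;>
    simp only [Fin.le_def] at * <;> omega

@[simp]
theorem residuePair_mkPos {k j l : ℕ} (hj : j ≤ l) (hl : l < k) :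
    residuePair (mkPos j l hj hl) = s((j : ZMod k), (l : ZMod k)) :=
  rfl

/-- The position map `tau` shifts both residues by one. -/
theorem residuePair_tau {k : ℕ} (p : PairIdx k) :
    residuePair (tau p) = (residuePair p).map (· + 1) := by
  have hlast {a : ℕ} (ha : a < k) (h : a = k - 1) : (a : ZMod k) + 1 = 0 := by
    rw [← Nat.cast_succ, show a.succ = k by omega, ZMod.natCast_self]
  have hle : p.1.1.val ≤ p.1.2.val := p.2
  have hlt : p.1.2.val < k := p.1.2.isLt
  by_cases h2 : p.1.2.val = k - 1
  · by_cases h1 : p.1.1.val = k - 1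
    · rw [show tau p = mkPos 0 0 le_rfl (by omega) from (dif_pos h2).trans (dif_pos h1),
        residuePair_mkPos]
      simp [residuePair, hlast (by omega) h1, hlast hlt h2]
    · rw [show tau p = mkPos 0 (p.1.1.val + 1) (Nat.zero_le _) (by omega) from
        (dif_pos h2).trans (dif_neg h1), residuePair_mkPos]
      simp [residuePair, hlast hlt h2]
  · rw [show tau p = mkPos (p.1.1.val + 1) (p.1.2.val + 1) (by omega) (by omega) from
      dif_neg h2, residuePair_mkPos]
    simp [residuePair]

theorem residuePair_iterate_tau {k : ℕ} (m : ℕ) (p : PairIdx k) :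
    residuePair (tau^[m] p) = (residuePair p).map (· + (m : ZMod k)) := by
  induction m with
  | zero => simp
  | succ m ih =>
    rw [Function.iterate_succ_apply', residuePair_tau, ih, Sym2.map_map]
    congr 1
    funext x
    simp [add_assoc]

/-- The permutation `π` (equivalently, its underlying position map `tau`) has order
exactly `k`. -/
theorem stmt7 (k : ℕ) (hk : 2 ≤ k) :
    (fun p : PairIdx k => tau p)^[k] = id ∧
    ∀ m : ℕ, 0 < m → m < k → (fun p : PairIdx k => tau p)^[m] ≠ id := by
  refine ⟨funext fun p => residuePair_injective ?_, fun m hm hmk h => ?_⟩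
  · simpa using residuePair_iterate_tau k p
  · have hp := residuePair_iterate_tau m (mkPos 0 0 le_rfl (by omega) : PairIdx k)
    rw [show tau^[m] = id from h, id_eq] at hp
    have h0 : (0 : ZMod k) = m := by simpa using hp
    exact hm.ne (natCast_zmod_inj_of_lt (by omega) hmk (by simpa using h0))
end

section
/- Let k ≥ 2 and n = k(k+1)/2, and view π as a permutation of the n positions indexed by pairs (j,l) with 1 ≤ j ≤ l ≤ k. If k is odd, then π decomposes into a product of exactly (k+1)/2 disjoint cycles (equivalently, the action of π on positions has exactly (k+1)/2 orbits); if k is even, then π decomposes into a product of exactly (k+2)/2 disjoint cycles. -/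
/-- The orbit invariant `min (l - j) (k - (l - j))` of the position `(j, l)`. -/
def foldedGap {k : ℕ} (p : PairIdx k) : ℕ :=
  min (p.1.2.val - p.1.1.val) (k - (p.1.2.val - p.1.1.val))

theorem PairIdx.eq_of_val_eq {k : ℕ} {p q : PairIdx k} (h₁ : p.1.1.val = q.1.1.val)
    (h₂ : p.1.2.val = q.1.2.val) : p = q :=
  Subtype.ext (Prod.ext (Fin.ext h₁) (Fin.ext h₂))

theorem foldedGap_tau {k : ℕ} (p : PairIdx k) : foldedGap (tau p) = foldedGap p := by
  have h : p.1.1.val ≤ p.1.2.val := p.2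
  have h' := p.1.2.isLt
  unfold foldedGap
  by_cases h₂ : p.1.2.val = k - 1
  · by_cases h₁ : p.1.1.val = k - 1 <;> simp [tau, h₁, h₂]
    omega
  · simp [tau, h₂]

theorem foldedGap_iterate_tau {k : ℕ} (a : ℕ) (p : PairIdx k) :
    foldedGap ((fun x : PairIdx k => tau x)^[a] p) = foldedGap p := by
  induction a with
  | zero => rfl
  | succ a ih => rw [Function.iterate_succ_apply', foldedGap_tau, ih]

theorem iterate_tau_mkPos {k d : ℕ} (hd : d < k) (j : ℕ) (hj : j + d < k) :
    (fun x : PairIdx k => tau x)^[j] (mkPos 0 d (Nat.zero_le d) hd) =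
      mkPos j (j + d) (Nat.le_add_right j d) hj := by
  induction j with
  | zero => exact PairIdx.eq_of_val_eq rfl (Nat.zero_add d).symm
  | succ j ih =>
    rw [Function.iterate_succ_apply', ih (by omega)]
    have h : j + d ≠ k - 1 := by omega
    apply PairIdx.eq_of_val_eq <;> simp [mkPos, tau, h]
    omega

theorem iterate_tau_mkPos_reflect {k d : ℕ} (hd0 : 0 < d) (hd : d < k) :
    (fun x : PairIdx k => tau x)^[k - d] (mkPos 0 d (Nat.zero_le d) hd) =
      mkPos 0 (k - d) (Nat.zero_le _) (by omega) := by
  obtain ⟨j, hj⟩ : ∃ j, k - d = j + 1 := ⟨k - d - 1, by omega⟩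
  have h₁ : j + d = k - 1 := by omega
  have h₂ : j ≠ k - 1 := by omega
  simp only [hj]
  rw [Function.iterate_succ_apply', iterate_tau_mkPos hd j (by omega)]
  apply PairIdx.eq_of_val_eq <;> simp [mkPos, tau, h₁, h₂]

theorem foldedGap_lt {k : ℕ} (p : PairIdx k) : foldedGap p < k / 2 + 1 := by
  unfold foldedGap
  omega

theorem foldedGap_lt_self {k : ℕ} (p : PairIdx k) : foldedGap p < k := by
  have := p.1.2.isLt
  unfold foldedGap
  omega

theorem orbitSetoid_mkPos_foldedGap {k : ℕ} (p : PairIdx k) :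
    orbitSetoid k (mkPos 0 (foldedGap p) (Nat.zero_le _) (foldedGap_lt_self p)) p := by
  have h : p.1.1.val ≤ p.1.2.val := p.2
  have hl := p.1.2.isLt
  obtain ⟨d, hd⟩ : ∃ d, p.1.2.val = p.1.1.val + d := ⟨p.1.2.val - p.1.1.val, by omega⟩
  have hdk : d < k := by omega
  have hp : orbitSetoid k (mkPos 0 d (Nat.zero_le d) hdk) p :=
    ⟨p.1.1.val, 0, (iterate_tau_mkPos hdk p.1.1.val (by omega)).trans
      (PairIdx.eq_of_val_eq rfl hd.symm)⟩
  have hg : foldedGap p = min d (k - d) := by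
    unfold foldedGap
    omega
  rcases le_total d (k - d) with hle | hle
  · simp only [hg, min_eq_left hle]
    exact hp
  · simp only [hg, min_eq_right hle]
    exact (orbitSetoid k).trans
      ((orbitSetoid k).symm ⟨k - d, 0, iterate_tau_mkPos_reflect (by omega) hdk⟩) hp

theorem orbitSetoid_iff_foldedGap_eq {k : ℕ} (p q : PairIdx k) :
    orbitSetoid k p q ↔ foldedGap p = foldedGap q := by
  constructor
  · rintro ⟨a, b, h⟩
    rw [← foldedGap_iterate_tau a p, h, foldedGap_iterate_tau]
  · intro h
    have hp := orbitSetoid_mkPos_foldedGap p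
    simp only [h] at hp
    exact (orbitSetoid k).trans ((orbitSetoid k).symm hp) (orbitSetoid_mkPos_foldedGap q)

theorem card_quotient_orbitSetoid {k : ℕ} (hk : 0 < k) :
    Nat.card (Quotient (orbitSetoid k)) = k / 2 + 1 := by
  let f : Quotient (orbitSetoid k) → Fin (k / 2 + 1) :=
    Quotient.lift (fun p => ⟨foldedGap p, foldedGap_lt p⟩)
      fun p q h => Fin.ext ((orbitSetoid_iff_foldedGap_eq p q).1 h)
  have hf : Function.Bijective f := by
    constructor
    · rintro ⟨p⟩ ⟨q⟩ h
      exact Quotient.sound ((orbitSetoid_iff_foldedGap_eq p q).2 (congrArg Fin.val h))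
    · rintro ⟨i, hi⟩
      refine ⟨Quotient.mk _ (mkPos 0 i (Nat.zero_le i) (by omega)), Fin.ext ?_⟩
      change min (i - 0) (k - (i - 0)) = i
      omega
  rw [Nat.card_eq_of_bijective f hf, Nat.card_fin]

/-- The number of disjoint cycles (orbits on positions) of `π` is `(k+1)/2` for odd `k`
and `(k+2)/2` for even `k`. -/
theorem stmt8 (k : ℕ) (hk : 2 ≤ k) :
    (Odd k → Nat.card (Quotient (orbitSetoid k)) = (k + 1) / 2) ∧
    (Even k → Nat.card (Quotient (orbitSetoid k)) = (k + 2) / 2) := by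
  rw [card_quotient_orbitSetoid (by omega)]
  constructor
  · rintro ⟨m, rfl⟩
    omega
  · rintro ⟨m, rfl⟩
    omega
end

section
/- Let k ≥ 2, n = k(k+1)/2, and let α be an n-tuple of pairwise independent irrational numbers with k(α) = k. Then there exists T > 1 such that for every t_0 ≥ T and every i ≥ 1, exactly k of the n functions ψ_{α_1}, …, ψ_{α_n} are discontinuous at t_i; that is, τ(t_i) = k, where {t_i} is the sequence of moments of permutation changes starting from t_0. -/
/-- The signed distance from `q α` to the nearest integer. -/
noncomputable def err (α : ℝ) (q : ℕ) : ℝ := (q : ℝ) * α - round ((q : ℝ) * α)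

/-- The distance from `q α` to the nearest integer. -/
noncomputable def nd (α : ℝ) (q : ℕ) : ℝ := distToInt ((q : ℝ) * α)

/-- `q` is the denominator of a best approximation: `‖q α‖ < ‖j α‖` for all `1 ≤ j < q`. -/
def IsBest (α : ℝ) (q : ℕ) : Prop :=
  1 ≤ q ∧ ∀ j, 1 ≤ j → j < q → nd α q < nd α j

/-- `q < q'` are consecutive denominators of best approximations. -/
def Consec (α : ℝ) (q q' : ℕ) : Prop :=
  IsBest α q ∧ IsBest α q' ∧ q < q' ∧ ∀ j, q < j → j < q' → ¬ IsBest α j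

lemma nd_eq_abs_err (α : ℝ) (q : ℕ) : nd α q = |err α q| := rfl

lemma nd_le (α : ℝ) (q : ℕ) (m : ℤ) : nd α q ≤ |(q : ℝ) * α - m| := round_le _ _

lemma nd_pos {α : ℝ} (h : Irrational α) {q : ℕ} (hq : 1 ≤ q) : 0 < nd α q := by
  rw [nd_eq_abs_err, abs_pos, err, sub_ne_zero]
  exact (h.natCast_mul (by omega)).ne_int _

lemma isBest_one (α : ℝ) : IsBest α 1 := ⟨le_refl _, fun j h1 h2 => by omega⟩

lemma exists_nd_le (α : ℝ) {n : ℕ} (hn : 0 < n) :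
    ∃ q : ℕ, 1 ≤ q ∧ q ≤ n ∧ nd α q ≤ 1 / (n + 1) := by
  obtain ⟨j, k, hk, hkn, h⟩ := Real.exists_int_int_abs_mul_sub_le α hn
  lift k to ℕ using hk.le
  refine ⟨k, by omega, by omega, (nd_le α k j).trans ?_⟩
  simpa using h

lemma Consec.one_le {α : ℝ} {q q' : ℕ} (h : Consec α q q') : 1 ≤ q := h.1.1

lemma Consec.nd_lt {α : ℝ} {q q' : ℕ} (h : Consec α q q') : nd α q' < nd α q :=
  h.2.1.2 q h.1.1 h.2.2.1

lemma Consec.nd_le_of_lt {α : ℝ} {q q' : ℕ} (h : Consec α q q') {j : ℕ} (h1 : 1 ≤ j)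
    (h2 : j < q') : nd α q ≤ nd α j := by
  by_contra! hlt
  have hex : ∃ j, 1 ≤ j ∧ nd α j < nd α q := ⟨j, h1, hlt⟩
  classical
  obtain ⟨ha, hb⟩ := Nat.find_spec hex
  have hmin : Nat.find hex ≤ j := Nat.find_min' hex ⟨h1, hlt⟩
  have hbest : IsBest α (Nat.find hex) := by
    refine ⟨ha, fun i hi1 hi2 => ?_⟩
    have := Nat.find_min hex hi2
    push Not at this
    exact hb.trans_le (this hi1)
  rcases lt_trichotomy (Nat.find hex) q with hlt' | heq | hgt
  · exact absurd (h.1.2 _ ha hlt') (not_lt.mpr hb.le)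
  · rw [heq] at hb; exact lt_irrefl _ hb
  · exact h.2.2.2 _ hgt (by omega) hbest

/-- The errors of consecutive best approximations alternate in sign. -/
lemma Consec.err_mul_neg {α : ℝ} (hα : Irrational α) {q q' : ℕ} (h : Consec α q q') :
    err α q * err α q' < 0 := by
  by_contra! hnn
  have hlt := h.nd_lt
  have hq := h.one_le
  have hqq := h.2.2.1
  have hp := nd_pos hα h.2.1.1
  have hle := h.nd_le_of_lt (j := q' - q) (by omega) (by omega)
  have h2 := nd_le α (q' - q) (round ((q' : ℝ) * α) - round ((q : ℝ) * α))
  have h3 : ((q' - q : ℕ) : ℝ) * α - ((round ((q' : ℝ) * α) - round ((q : ℝ) * α) : ℤ) : ℝ)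
      = err α q' - err α q := by
    rw [Nat.cast_sub hqq.le]; push_cast; unfold err; ring
  rw [h3] at h2
  rw [nd_eq_abs_err, nd_eq_abs_err] at hlt
  rw [nd_eq_abs_err] at hp hle
  have h4 : |err α q' - err α q| < |err α q| := by
    rcases le_total 0 (err α q) with h0 | h0
    · have : 0 ≤ err α q' := by
        by_contra! hc
        have : err α q * err α q' = 0 := le_antisymm (mul_nonpos_of_nonneg_of_nonpos h0 hc.le) hnn
        rcases mul_eq_zero.mp this with h5 | h5
        · rw [h5, abs_zero] at hlt; linarith
        · linarith
      rw [abs_of_nonneg h0, abs_of_nonneg this] at *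
      rw [abs_lt]; constructor <;> linarith
    · have : err α q' ≤ 0 := by
        by_contra! hc
        have : err α q * err α q' = 0 := le_antisymm (mul_nonpos_of_nonpos_of_nonneg h0 hc.le) hnn
        rcases mul_eq_zero.mp this with h5 | h5
        · rw [h5, abs_zero] at hlt; linarith
        · linarith
      rw [abs_of_nonpos h0, abs_of_nonpos this] at *
      rw [abs_lt]; constructor <;> linarith
  linarith

lemma abs_sub_mul_of_mul_neg {x y a b : ℝ} (ha : 0 ≤ a) (hb : 0 ≤ b) (h : x * y < 0) :
    |a * y - b * x| = |x| * b + |y| * a := by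
  rcases mul_neg_iff.mp h with ⟨hx, hy⟩ | ⟨hx, hy⟩
  · rw [abs_of_pos hx, abs_of_neg hy, abs_of_nonpos (by nlinarith)]; ring
  · rw [abs_of_neg hx, abs_of_pos hy, abs_of_nonneg (by nlinarith)]; ring

lemma mul_err_sub (α : ℝ) (q q' : ℕ) :
    (q : ℝ) * err α q' - q' * err α q =
      ((q' * round ((q : ℝ) * α) - q * round ((q' : ℝ) * α) : ℤ) : ℝ) := by
  push_cast; unfold err; ring

lemma Consec.nd_mul_add {α : ℝ} (hα : Irrational α) {q q' : ℕ} (h : Consec α q q') :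
    nd α q * q' + nd α q' * q = 1 := by
  have hq := h.one_le
  have hqq := h.2.2.1
  have hlt := h.nd_lt
  have hp := nd_pos hα h.2.1.1
  have hs := abs_sub_mul_of_mul_neg (Nat.cast_nonneg q) (Nat.cast_nonneg q')
    (h.err_mul_neg hα)
  rw [mul_err_sub, ← nd_eq_abs_err, ← nd_eq_abs_err, ← Int.cast_abs] at hs
  obtain ⟨j, hj1, hj2, hj3⟩ := exists_nd_le α (n := q' - 1) (by omega)
  have h1 := (h.nd_le_of_lt hj1 (by omega)).trans hj3
  have hcast : ((q' - 1 : ℕ) : ℝ) + 1 = q' := by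
    rw [Nat.cast_sub (by omega)]; simp
  have hq0 : (0 : ℝ) < q := by exact_mod_cast hq
  have hq'0 : (0 : ℝ) < q' := by exact_mod_cast (by omega : 0 < q')
  have hqlt : (q : ℝ) < q' := by exact_mod_cast hqq
  rw [hcast, le_div_iff₀ hq'0] at h1
  have h2 : nd α q' * q < 1 := by nlinarith
  have h3 : 0 < nd α q * q' + nd α q' * q := by
    have := hp.trans hlt; positivity
  rw [← hs] at h3 ⊢
  have h4 : ((|q' * round ((q : ℝ) * α) - q * round ((q' : ℝ) * α)| : ℤ) : ℝ) < (2 : ℤ) := by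
    rw [hs]; push_cast; linarith
  have h5 := Int.cast_lt.mp h4
  have h6 : (0 : ℤ) < |q' * round ((q : ℝ) * α) - q * round ((q' : ℝ) * α)| := by
    exact_mod_cast h3
  have h7 : |(q' : ℤ) * round ((q : ℝ) * α) - q * round ((q' : ℝ) * α)| = 1 := by omega
  rw [h7]; simp

lemma Consec.exists_recurrence {α : ℝ} (hα : Irrational α) {q q' q'' : ℕ} (h : Consec α q q')
    (h' : Consec α q' q'') :
    ∃ c : ℕ, 1 ≤ c ∧ q'' = c * q' + q ∧ nd α q = c * nd α q' + nd α q'' := by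
  have s1 := h.err_mul_neg hα
  have s2 := h'.err_mul_neg hα
  have e1 := h.nd_mul_add hα
  have e2 := h'.nd_mul_add hα
  have a1 := abs_sub_mul_of_mul_neg (Nat.cast_nonneg q) (Nat.cast_nonneg q') s1
  have a2 := abs_sub_mul_of_mul_neg (Nat.cast_nonneg q') (Nat.cast_nonneg q'') s2
  have hqq := h.2.2.1
  have hqq' := h'.2.2.1
  have hq := h.one_le
  rw [← nd_eq_abs_err, ← nd_eq_abs_err] at a1 a2
  rw [e1] at a1
  rw [e2] at a2
  have hsum : ((q : ℝ) * err α q' - q' * err α q) + (q' * err α q'' - q'' * err α q') = 0 := by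
    have hq0 : (0 : ℝ) ≤ q := Nat.cast_nonneg q
    have hq'0 : (0 : ℝ) ≤ q' := Nat.cast_nonneg q'
    have hq''0 : (0 : ℝ) ≤ q'' := Nat.cast_nonneg q''
    rcases mul_neg_iff.mp s1 with ⟨hx, hy⟩ | ⟨hx, hy⟩ <;>
    rcases mul_neg_iff.mp s2 with ⟨hx', hy'⟩ | ⟨hx', hy'⟩
    · linarith
    · rw [abs_of_nonpos (by nlinarith)] at a1
      rw [abs_of_nonneg (by nlinarith)] at a2
      linarith
    · rw [abs_of_nonneg (by nlinarith)] at a1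
      rw [abs_of_nonpos (by nlinarith)] at a2
      linarith
    · linarith
  set m := round ((q : ℝ) * α) with hm
  set m' := round ((q' : ℝ) * α) with hm'
  set m'' := round ((q'' : ℝ) * α) with hm''
  rw [mul_err_sub, mul_err_sub, ← Int.cast_add, ← hm, ← hm', ← hm''] at hsum
  rw [mul_err_sub, ← hm, ← hm', ← Int.cast_abs] at a1
  have hsum' : (q' * m - q * m' : ℤ) + (q'' * m' - q' * m'') = 0 := by exact_mod_cast hsum
  have a1' : |(q' * m - q * m' : ℤ)| = 1 := by exact_mod_cast a1
  have hcop : IsCoprime (q' : ℤ) m' := by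
    rcases (abs_eq (by norm_num)).mp a1' with h1 | h1
    · exact ⟨m, -q, by linarith⟩
    · exact ⟨-m, q, by linarith⟩
  have hdvd : (q' : ℤ) ∣ (q'' - q) := by
    refine hcop.dvd_of_dvd_mul_left ⟨m'' - m, ?_⟩
    linarith
  obtain ⟨c, hc⟩ := hdvd
  have hcpos : 0 < c := by
    by_contra! hneg
    have : (q' : ℤ) * c ≤ 0 := mul_nonpos_of_nonneg_of_nonpos (by omega) hneg
    omega
  have hmc : m'' - m = c * m' := by
    have hq'ne : (q' : ℤ) ≠ 0 := by omega
    apply mul_left_cancel₀ hq'ne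
    linear_combination m' * hc - hsum'
  lift c to ℕ using hcpos.le
  refine ⟨c, by omega, by zify; linarith, ?_⟩
  have herr : err α q'' = err α q + c * err α q' := by
    have h1 : (q'' : ℝ) - q = q' * c := by exact_mod_cast hc
    have h2 : (m'' : ℝ) - m = c * m' := by exact_mod_cast hmc
    unfold err
    rw [← hm, ← hm', ← hm'']
    linear_combination α * h1 - h2
  have hc0 : (0 : ℝ) ≤ c := Nat.cast_nonneg c
  rw [nd_eq_abs_err, nd_eq_abs_err, nd_eq_abs_err]
  rcases mul_neg_iff.mp s1 with ⟨hx, hy⟩ | ⟨hx, hy⟩ <;>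
  rcases mul_neg_iff.mp s2 with ⟨hx', hy'⟩ | ⟨hx', hy'⟩
  · linarith
  · rw [abs_of_pos hx, abs_of_neg hy, abs_of_pos hy']; linarith
  · rw [abs_of_neg hx, abs_of_pos hy, abs_of_neg hy']; linarith
  · linarith

lemma exists_isBest_gt {α : ℝ} (hα : Irrational α) (m : ℕ) : ∃ q, m < q ∧ IsBest α q := by
  classical
  obtain ⟨ε, hε, hle⟩ : ∃ ε > 0, ∀ j, 1 ≤ j → j ≤ m → ε ≤ nd α j := by
    induction m with
    | zero => exact ⟨1, one_pos, fun j h1 h2 => by omega⟩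
    | succ m ih =>
      obtain ⟨ε, hε, h⟩ := ih
      refine ⟨min ε (nd α (m + 1)), lt_min hε (nd_pos hα (by omega)), fun j h1 h2 => ?_⟩
      rcases Nat.lt_or_ge m j with hj | hj
      · rw [show j = m + 1 by omega]; exact min_le_right _ _
      · exact (min_le_left _ _).trans (h j h1 hj)
  have hex : ∃ q, 1 ≤ q ∧ nd α q < ε := by
    obtain ⟨n, hn⟩ := exists_nat_one_div_lt hε
    obtain ⟨q, h1, -, h2⟩ := exists_nd_le α (n := n + 1) (by omega)
    refine ⟨q, h1, h2.trans_lt (lt_of_le_of_lt ?_ hn)⟩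
    apply one_div_le_one_div_of_le <;> push_cast <;> [positivity; linarith]
  obtain ⟨h1, h2⟩ := Nat.find_spec hex
  have hgt : m < Nat.find hex := by
    by_contra! hc
    exact absurd h2 (not_lt.mpr (hle _ h1 hc))
  refine ⟨_, hgt, h1, fun j hj1 hj2 => h2.trans_le ?_⟩
  have := Nat.find_min hex hj2
  push Not at this
  exact this hj1

lemma exists_consec_around {α : ℝ} (hα : Irrational α) {m : ℕ} (hm : 1 ≤ m) :
    ∃ q q', Consec α q q' ∧ q ≤ m ∧ m < q' := by
  classical
  have hex := exists_isBest_gt hα m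
  obtain ⟨h1, h2⟩ := Nat.find_spec hex
  have hq : IsBest α (Nat.findGreatest (IsBest α) m) :=
    Nat.findGreatest_spec (P := IsBest α) hm (isBest_one α)
  have hqm := Nat.findGreatest_le (P := IsBest α) m
  refine ⟨_, _, ⟨hq, h2, by omega, fun j hj1 hj2 hj3 => ?_⟩, hqm, h1⟩
  rcases Nat.lt_or_ge m j with hj | hj
  · exact Nat.find_min hex hj2 ⟨hj, hj3⟩
  · exact Nat.findGreatest_is_greatest hj1 hj hj3

lemma exists_consec_left {α : ℝ} (hα : Irrational α) {t : ℕ} (ht : IsBest α t) (h1 : 1 < t) :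
    ∃ q, Consec α q t := by
  obtain ⟨q, q', h, h2, h3⟩ := exists_consec_around hα (m := t - 1) (by omega)
  have : q' = t := by
    by_contra hne
    exact h.2.2.2 t (by omega) (by omega) ht
  exact ⟨q, this ▸ h⟩

lemma exists_consec_right {α : ℝ} (hα : Irrational α) {t : ℕ} (ht : IsBest α t) :
    ∃ q, Consec α t q := by
  obtain ⟨q, q', h, h2, h3⟩ := exists_consec_around hα ht.1
  have : q = t := by
    by_contra hne
    exact h.2.2.2 t (by omega) (by omega) ht
  exact ⟨q', this ▸ h⟩

lemma Consec.le_left {α : ℝ} {q q' r : ℕ} (h : Consec α q q') (hr : IsBest α r) (hlt : r < q') :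
    r ≤ q := by
  by_contra! hc
  exact h.2.2.2 r hc hlt hr

lemma Consec.le_right {α : ℝ} {q q' r : ℕ} (h : Consec α q q') (hr : IsBest α r) (hlt : q < r) :
    q' ≤ r := by
  by_contra! hc
  exact h.2.2.2 r hlt hc hr

lemma psi_eq_nd {α t : ℝ} {q : ℕ} (h1 : 1 ≤ q) (h2 : (q : ℝ) ≤ t)
    (h : ∀ j : ℕ, 1 ≤ j → (j : ℝ) ≤ t → nd α q ≤ nd α j) : psi α t = nd α q := by
  apply IsLeast.csInf_eq
  refine ⟨⟨(q : ℤ), ⟨by exact_mod_cast h1, by exact_mod_cast h2⟩, by simp [nd]⟩, ?_⟩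
  rintro _ ⟨j, ⟨hj1, hj2⟩, rfl⟩
  lift j to ℕ using by omega
  simpa [nd] using h j (by exact_mod_cast hj1) (by exact_mod_cast hj2)

lemma Consec.psi_eq {α : ℝ} {q q' : ℕ} (h : Consec α q q') {m : ℕ} (h1 : q ≤ m) (h2 : m < q') :
    psi α (m : ℝ) = nd α q :=
  psi_eq_nd h.one_le (by exact_mod_cast h1) fun j hj1 hj2 => h.nd_le_of_lt hj1 (by
    have : j ≤ m := by exact_mod_cast hj2
    omega)

lemma psi_floor (α : ℝ) {t : ℝ} (ht : 0 ≤ t) : psi α (⌊t⌋₊ : ℝ) = psi α t := by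
  unfold psi
  congr 2
  ext q
  simp only [Set.mem_ofPred_eq, and_congr_right_iff]
  intro hq
  lift q to ℕ using by omega
  simp [Nat.le_floor_iff ht]

lemma Consec.nd_mul_lt_one {α : ℝ} (hα : Irrational α) {q q' : ℕ} (h : Consec α q q') :
    nd α q * q' < 1 := by
  have h1 := h.nd_mul_add hα
  have h2 := nd_pos hα h.2.1.1
  have h3 : (0 : ℝ) < q := by exact_mod_cast h.one_le
  have := mul_pos h2 h3
  linarith

/-- If `β` makes two consecutive jumps `s < s'` inside one step of `α`, then `β` was above `α`
before the first of them. -/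
lemma Consec.nd_lt_of_two_jumps {α β : ℝ} (hα : Irrational α) (hβ : Irrational β)
    {q q' s₀ s s' : ℕ} (h : Consec α q q') (h₀ : Consec β s₀ s) (h₁ : Consec β s s')
    (hle : s' ≤ q') : nd α q < nd β s₀ := by
  obtain ⟨c, hc, -, hrec⟩ := h₀.exists_recurrence hβ h₁
  have h2 := h₁.nd_mul_add hβ
  have h3 := h.nd_mul_lt_one hα
  have p1 := nd_pos hβ h₁.1.1
  have p2 := nd_pos hβ h₁.2.1.1
  have p3 := nd_pos hα h.1.1
  have hc' : (1 : ℝ) ≤ c := by exact_mod_cast hc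
  have hss : (s : ℝ) < s' := by exact_mod_cast h₁.2.2.1
  have hsq : (s' : ℝ) ≤ q' := by exact_mod_cast hle
  have hs' : (0 : ℝ) < s' := by exact_mod_cast h₁.2.1.1
  have h4 : nd β s + nd β s' ≤ nd β s₀ := by nlinarith
  by_contra! hc
  have h5 : (nd β s + nd β s') * s' ≤ nd α q * q' :=
    mul_le_mul (h4.trans hc) hsq hs'.le p3.le
  nlinarith

/-- Scaled by `t`, the distances `‖q α‖` are integers up to `q ‖t α‖`. -/
lemma exists_abs_mul_nd_sub_le (α : ℝ) (t q : ℕ) :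
    ∃ K : ℤ, |t * nd α q - K| ≤ q * nd α t := by
  have key : (t : ℝ) * err α q
      = ((q * round ((t : ℝ) * α) - t * round ((q : ℝ) * α) : ℤ) : ℝ) + q * err α t := by
    push_cast; unfold err; ring
  set K : ℤ := q * round ((t : ℝ) * α) - t * round ((q : ℝ) * α)
  refine ⟨|K|, ?_⟩
  have h1 : (t : ℝ) * nd α q = |(K : ℝ) + q * err α t| := by
    rw [← key, abs_mul, Nat.abs_cast, nd_eq_abs_err]
  have h2 : (q : ℝ) * nd α t = |(q : ℝ) * err α t| := by
    rw [abs_mul, Nat.abs_cast, nd_eq_abs_err]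
  rw [h1, h2, Int.cast_abs]
  refine (abs_abs_sub_abs_le_abs_sub _ _).trans_eq ?_
  rw [add_sub_cancel_left]

/-- If two functions jump together at `t` and have different previous jumps, then their order
was opposite just before the previous jump of the lower one. -/
lemma psi_lt_psi_before_jump {α β : ℝ} (hα : Irrational α) (hβ : Irrational β) {y z t : ℕ}
    (hy : 1 < y) (h : Consec α y t) (h' : Consec β z t) (hlt : nd α y < nd β z) (hne : y ≠ z) :
    psi β ((y - 1 : ℕ) : ℝ) < psi α ((y - 1 : ℕ) : ℝ) := by
  obtain ⟨p, hp⟩ := exists_consec_left hα h.1 hy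
  have hpy := hp.2.2.1
  rw [hp.psi_eq (m := y - 1) (by omega) (by omega)]
  rcases Nat.lt_or_ge z y with hzy | hzy
  · rw [h'.psi_eq (m := y - 1) (by omega) (by have := h.2.2.1; omega)]
    exact h'.nd_lt_of_two_jumps hβ hα hp h le_rfl
  have hyz : y < z := by omega
  obtain ⟨u, s, hus, hu, hs⟩ := exists_consec_around hβ (m := y - 1) (by omega)
  rw [hus.psi_eq hu hs]
  have hsz : s ≤ z := hus.le_right h'.1 (by omega)
  have hdec : nd β z ≤ nd β s := by
    rcases hsz.eq_or_lt with rfl | hlt'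
    · exact le_rfl
    · exact (h'.1.2 s hus.2.1.1 hlt').le
  by_contra! hcon
  obtain ⟨t', ht'⟩ := exists_consec_right hβ h'.2.1
  obtain ⟨c, hc, htc, hrec⟩ := hp.exists_recurrence hα h
  obtain ⟨c', hc', htc', -⟩ := h'.exists_recurrence hβ ht'
  obtain ⟨K, hK⟩ := exists_abs_mul_nd_sub_le β t u
  have e1 := hp.nd_mul_add hα
  have e2 := hus.nd_mul_add hβ
  have e3 := h.nd_mul_add hα
  have e4 := h'.nd_mul_add hβ
  have e5 := ht'.nd_mul_lt_one hβ
  have pαp := nd_pos hα hp.1.1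
  have pαy := nd_pos hα h.1.1
  have pαt := nd_pos hα h.2.1.1
  have pβt := nd_pos hβ h'.2.1.1
  have pβu := nd_pos hβ hus.1.1
  have hu0 : (1 : ℝ) ≤ u := by exact_mod_cast hus.1.1
  have hp0 : (1 : ℝ) ≤ p := by exact_mod_cast hp.1.1
  have hys : (y : ℝ) ≤ s := by exact_mod_cast (by omega : y ≤ s)
  have hyz' : (y : ℝ) < z := by exact_mod_cast hyz
  have hpy' : (p : ℝ) < y := by exact_mod_cast hpy
  have hyt : (y : ℝ) < t := by exact_mod_cast h.2.2.1
  have ht0 : (0 : ℝ) < t := by linarith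
  have htc1 : (t : ℝ) = c * y + p := by exact_mod_cast htc
  have ht'le : (t : ℝ) + z ≤ t' := by
    have : t + z ≤ t' := by
      rw [htc']
      exact Nat.add_le_add_right (Nat.le_mul_of_pos_left t hc') z
    exact_mod_cast this
  -- the previous jump of `β` before `y` lies to the left of the one of `α`
  have hup : (u : ℝ) < p := by
    have h1 : nd α p * y ≤ nd β u * s := mul_le_mul hcon hys (by linarith) pβu.le
    have h2 : nd β s * u ≤ nd α y * p := by linarith
    by_contra! hc
    have : nd α y * p < nd β s * u :=
      mul_lt_mul (hlt.trans_le hdec) hc (by linarith) (by linarith)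
    linarith
  have hδ : nd β t < nd α t := by
    have h1 : nd α y * t < nd β z * t := mul_lt_mul_of_pos_right hlt ht0
    have h2 : nd β t * z < nd α t * y := by linarith
    by_contra! hc
    have h3 : nd α t * y ≤ nd β t * z := mul_le_mul hc hyz'.le (by linarith) pβt.le
    linarith
  have hαp : t * nd α p = c + nd α t * p := by
    rw [hrec]; linear_combination c * e3 + nd α t * htc1
  have hKc : (c : ℤ) < K := by
    by_contra! hle
    have hle' : (K : ℝ) ≤ c := by exact_mod_cast hle
    have h1 := (abs_le.mp hK).2
    have h2 : (t : ℝ) * nd α p ≤ t * nd β u :=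
      mul_le_mul_of_nonneg_left hcon ht0.le
    have h3 : (u : ℝ) * nd β t < p * nd α t := mul_lt_mul hup hδ.le pβt (by linarith)
    linarith
  have hKc' : (c : ℝ) + 1 ≤ K := by exact_mod_cast hKc
  have h1 := (abs_le.mp hK).1
  have h2 : (c : ℝ) + 1 - u * nd β t ≤ t * nd β u := by linarith
  have h3 : 1 - nd β t * z ≤ t * nd β s := by
    have : t * nd β z ≤ t * nd β s := mul_le_mul_of_nonneg_left hdec ht0.le
    linarith
  have h4 : (t : ℝ) = t * nd β u * s + t * nd β s * u := by linear_combination - t * e2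
  have h5 : ((c : ℝ) + 1 - u * nd β t) * y ≤ t * nd β u * s := by
    exact mul_le_mul h2 hys (by linarith) (by positivity)
  have h6 : (1 - nd β t * z) * u ≤ t * nd β s * u :=
    mul_le_mul_of_nonneg_right h3 (by linarith)
  have h7 : nd β t * (y + z) < 1 := by
    have : nd β t * (y + z) ≤ nd β t * t' := mul_le_mul_of_nonneg_left (by linarith) pβt.le
    linarith
  have h8 : 0 < u * (1 - nd β t * (y + z)) := by
    apply mul_pos <;> linarith
  linarith

/-- Two consecutive denominators determine all the previous ones. -/
lemma isBest_iff_of_consec {α β : ℝ} (hα : Irrational α) (hβ : Irrational β) (q : ℕ) :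
    ∀ q', Consec α q q' → Consec β q q' → ∀ j ≤ q', (IsBest α j ↔ IsBest β j) := by
  induction q using Nat.strong_induction_on with
  | _ q ih =>
    intro q' h h' j hj
    rcases hj.eq_or_lt with rfl | hj
    · exact ⟨fun _ => h'.2.1, fun _ => h.2.1⟩
    rcases Nat.lt_or_ge q j with hqj | hqj
    · exact ⟨fun hb => absurd hb (h.2.2.2 j hqj hj), fun hb => absurd hb (h'.2.2.2 j hqj hj)⟩
    rcases h.one_le.eq_or_lt with h1 | h1
    · subst h1
      rcases Nat.le_one_iff_eq_zero_or_eq_one.mp hqj with rfl | rfl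
      · exact ⟨fun hb => absurd hb.1 (by omega), fun hb => absurd hb.1 (by omega)⟩
      · exact ⟨fun _ => isBest_one _, fun _ => isBest_one _⟩
    obtain ⟨p, hp⟩ := exists_consec_left hα h.1 h1
    obtain ⟨r, hr⟩ := exists_consec_left hβ h'.1 h1
    obtain ⟨c, -, hc, -⟩ := hp.exists_recurrence hα h
    obtain ⟨d, -, hd, -⟩ := hr.exists_recurrence hβ h'
    have hpr : p = r := by
      have e1 : q' % q = p := by
        rw [hc, Nat.mul_add_mod_of_lt hp.2.2.1]
      have e2 : q' % q = r := by
        rw [hd, Nat.mul_add_mod_of_lt hr.2.2.1]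
      omega
    subst hpr
    exact ih p hp.2.2.1 q hp hr j hqj

/-- Eventually distinct functions share two consecutive denominators only finitely often. -/
lemma eventually_not_consec {α β : ℝ} (hα : Irrational α) (hβ : Irrational β) {N : ℕ}
    (hne : ∀ m : ℕ, N ≤ m → psi α m ≠ psi β m) :
    ∃ M : ℕ, ∀ q q', M ≤ q → Consec α q q' → ¬ Consec β q q' := by
  by_contra! hcon
  have hiff : ∀ j, IsBest α j ↔ IsBest β j := fun j => by
    obtain ⟨q, q', hq, h1, h2⟩ := hcon j
    exact isBest_iff_of_consec hα hβ q q' h1 h2 j (by have := h1.2.2.1; omega)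
  have hcons : ∀ {q q'}, Consec α q q' → Consec β q q' := fun h =>
    ⟨(hiff _).mp h.1, (hiff _).mp h.2.1, h.2.2.1, fun j h1 h2 h3 =>
      h.2.2.2 j h1 h2 ((hiff j).mpr h3)⟩
  obtain ⟨a, haN, ha⟩ := exists_isBest_gt hα N
  have hgrow : ∀ m : ℕ, ∃ q, m ≤ q ∧ IsBest α q ∧ |nd α a - nd β a| ≤ |nd α q - nd β q| := by
    intro m
    induction m with
    | zero => exact ⟨a, by omega, ha, le_rfl⟩
    | succ m ih =>
      obtain ⟨q, hq, hb, hle⟩ := ih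
      obtain ⟨q', h⟩ := exists_consec_right hα hb
      refine ⟨q', by have := h.2.2.1; omega, h.2.1, hle.trans ?_⟩
      have e1 := h.nd_mul_add hα
      have e2 := (hcons h).nd_mul_add hβ
      have hqq : (q : ℝ) ≤ q' := by exact_mod_cast h.2.2.1.le
      have hq0 : (0 : ℝ) < q := by exact_mod_cast h.1.1
      have e3 : (nd α q - nd β q) * q' = -((nd α q' - nd β q') * q) := by linarith
      have e4 : |nd α q - nd β q| * q' = |nd α q' - nd β q'| * q := by
        have := congrArg abs e3
        rwa [abs_neg, abs_mul, abs_mul, Nat.abs_cast, Nat.abs_cast] at this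
      have e5 : |nd α q - nd β q| * q ≤ |nd α q' - nd β q'| * q := by
        rw [← e4]; exact mul_le_mul_of_nonneg_left hqq (abs_nonneg _)
      exact le_of_mul_le_mul_right e5 hq0
  have hd : 0 < |nd α a - nd β a| := by
    rw [abs_pos, sub_ne_zero]
    obtain ⟨a', h⟩ := exists_consec_right hα ha
    have := hne a haN.le
    rwa [h.psi_eq le_rfl h.2.2.1, (hcons h).psi_eq le_rfl h.2.2.1] at this
  obtain ⟨m, hm⟩ := exists_nat_one_div_lt hd
  obtain ⟨q, hq, hb, hle⟩ := hgrow (m + 1)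
  obtain ⟨q', h⟩ := exists_consec_right hα hb
  have e1 := h.nd_mul_lt_one hα
  have e2 := (hcons h).nd_mul_lt_one hβ
  have p1 := nd_pos hα h.1.1
  have p2 := nd_pos hβ h.1.1
  have hmq : (m : ℝ) + 1 ≤ q' := by
    exact_mod_cast (by have := h.2.2.1; omega : m + 1 ≤ q')
  have hm0 : (0 : ℝ) < (m : ℝ) + 1 := by positivity
  have e3 : |nd α q - nd β q| * (m + 1) < 1 := by
    have f1 : nd α q * (m + 1) < 1 := lt_of_le_of_lt (mul_le_mul_of_nonneg_left hmq p1.le) e1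
    have f2 : nd β q * (m + 1) < 1 := lt_of_le_of_lt (mul_le_mul_of_nonneg_left hmq p2.le) e2
    rcases abs_cases (nd α q - nd β q) with ⟨h, _⟩ | ⟨h, _⟩ <;> rw [h] <;> nlinarith
  rw [div_lt_iff₀ hm0] at hm
  nlinarith

/-- Of two eventually distinct functions each one is the smaller one infinitely often. -/
lemma exists_psi_lt {α β : ℝ} (hα : Irrational α) (hβ : Irrational β) {N : ℕ}
    (hne : ∀ m : ℕ, N ≤ m → psi α m ≠ psi β m) (n : ℕ) :
    ∃ m : ℕ, n ≤ m ∧ psi α m < psi β m := by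
  by_contra! hcon
  obtain ⟨M, hM⟩ := eventually_not_consec hα hβ hne
  set L := max N (max n M) + 2 with hL
  have hlt : ∀ m : ℕ, L - 2 ≤ m → psi β m < psi α m := fun m hm =>
    lt_of_le_of_ne (hcon m (by omega)) (hne m (by omega)).symm
  obtain ⟨r, hr, hrb⟩ := exists_isBest_gt hβ L
  obtain ⟨l, hl, hlb⟩ := exists_isBest_gt hα L
  have hsim : ∀ t, max r l < t → IsBest α t → ¬ IsBest β t := by
    intro t ht h1 h2
    obtain ⟨y, hy⟩ := exists_consec_left hβ h2 (by omega)
    obtain ⟨z, hz⟩ := exists_consec_left hα h1 (by omega)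
    have hy' := hy.le_left hrb (by omega)
    have hyt := hy.2.2.1
    have hzt := hz.2.2.1
    have e1 := hlt (t - 1) (by omega)
    rw [hy.psi_eq (by omega) (by omega), hz.psi_eq (by omega) (by omega)] at e1
    have e2 := psi_lt_psi_before_jump hβ hα (by omega) hy hz e1 (by
      rintro rfl
      exact hM y t (by omega) hz hy)
    exact absurd e2 (not_lt.mpr (hlt _ (by omega)).le)
  obtain ⟨s₀, hs₀, hb₀⟩ := exists_isBest_gt hβ (max r l)
  obtain ⟨s, h₀⟩ := exists_consec_right hβ hb₀
  obtain ⟨s', h₁⟩ := exists_consec_right hβ h₀.2.1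
  obtain ⟨s'', h₂⟩ := exists_consec_right hβ h₁.2.1
  have l0 := h₀.2.2.1
  have l1 := h₁.2.2.1
  have l2 := h₂.2.2.1
  obtain ⟨q, q', h, hq, hq'⟩ := exists_consec_around hα (m := s' - 1) (by omega)
  have lq := h.2.2.1
  have hsq : s < q := by
    rcases lt_trichotomy q s with h3 | h3 | h3
    · have e1 := h.nd_lt_of_two_jumps hα hβ h₀ h₁ (by omega)
      have e2 := hlt (s - 1) (by omega)
      have e3 : l ≤ q := h.le_left hlb (by omega)
      rw [h₀.psi_eq (by omega) (by omega), h.psi_eq (by omega) (by omega)] at e2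
      linarith
    · exact absurd h₁.1 (hsim s (by omega) (h3 ▸ h.1))
    · exact h3
  have hne' : q' ≠ s' := by
    rintro rfl
    exact hsim q' (by omega) h.2.1 h₁.2.1
  have hlt'' : q' < s'' := by
    by_contra! hc
    have e1 := h.nd_lt_of_two_jumps hα hβ h₁ h₂ hc
    have e2 := hlt (s' - 1) (by omega)
    rw [h₁.psi_eq (by omega) (by omega), h.psi_eq (by omega) (by omega)] at e2
    linarith
  obtain ⟨q'', h'⟩ := exists_consec_right hα h.2.1
  have e1 := hlt q' (by omega)
  rw [h₂.psi_eq (by omega) (by omega), h'.psi_eq le_rfl h'.2.2.1] at e1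
  have e2 := hlt (s' - 1) (by omega)
  rw [h₁.psi_eq (by omega) (by omega), h.psi_eq (by omega) (by omega)] at e2
  have f1 := h.nd_mul_add hα
  have f2 := h₁.nd_mul_add hβ
  have p1 := nd_pos hβ h₁.1.1
  have p2 := nd_pos hβ h₁.2.1.1
  have g1 : nd β s * s' ≤ nd α q * q' :=
    mul_le_mul e2.le (by exact_mod_cast (by omega : s' ≤ q')) (by positivity) (by linarith)
  have g2 : nd β s' * s < nd α q' * q :=
    mul_lt_mul e1 (by exact_mod_cast hsq.le)
      (by exact_mod_cast h₁.1.1) (by linarith)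
  linarith

lemma psi_le_psi (α : ℝ) {s t : ℝ} (hs : 1 ≤ s) (hst : s ≤ t) : psi α t ≤ psi α s := by
  refine csInf_le_csInf ⟨0, ?_⟩ ⟨_, ⟨1, ⟨le_rfl, by simpa using hs⟩, rfl⟩⟩
    (Set.image_mono fun q hq => ⟨hq.1, hq.2.trans hst⟩)
  rintro _ ⟨q, -, rfl⟩
  exact abs_nonneg _

lemma psi_pred_eq {α : ℝ} (hα : Irrational α) {t : ℕ} (ht : 1 < t) (hb : ¬ IsBest α t) :
    psi α ((t - 1 : ℕ) : ℝ) = psi α t := by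
  obtain ⟨q, q', h, h1, h2⟩ := exists_consec_around hα ht.le
  have hne : q ≠ t := by
    rintro rfl
    exact hb h.1
  rw [h.psi_eq h1 h2, h.psi_eq (m := t - 1) (by omega) (by omega)]

lemma psi_lt_psi_pred {α : ℝ} (hα : Irrational α) {t : ℕ} (ht : 1 < t) (hb : IsBest α t) :
    psi α t < psi α ((t - 1 : ℕ) : ℝ) := by
  obtain ⟨y, hy⟩ := exists_consec_left hα hb ht
  obtain ⟨z, hz⟩ := exists_consec_right hα hb
  have := hy.2.2.1
  rw [hz.psi_eq le_rfl hz.2.2.1, hy.psi_eq (m := t - 1) (by omega) (by omega)]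
  exact hy.nd_lt

/-- The relative order at time `t` of the functions with indices in `S`. -/
def ordRel {n : ℕ} (α : Fin n → ℝ) (S : Finset (Fin n)) (t : ℕ) : Fin n → Fin n → Prop :=
  fun i j => i ∈ S ∧ j ∈ S ∧ psi (α i) t < psi (α j) t

/-- The relative orders that occur at arbitrarily large times. -/
def recurrentOrd {n : ℕ} (α : Fin n → ℝ) (S : Finset (Fin n)) : Set (Fin n → Fin n → Prop) :=
  {R | ∃ᶠ t in Filter.atTop, ordRel α S t = R}

lemma eventually_mem_recurrentOrd {n : ℕ} (α : Fin n → ℝ) :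
    ∀ᶠ t in Filter.atTop, ∀ S, ordRel α S t ∈ recurrentOrd α S := by
  have h : ∀ S, ∀ R, ∀ᶠ t in Filter.atTop, ordRel α S t = R → R ∈ recurrentOrd α S := by
    intro S R
    by_cases hR : R ∈ recurrentOrd α S
    · exact Filter.Eventually.of_forall fun _ _ => hR
    · filter_upwards [Filter.not_frequently.mp hR] with t ht h
      exact absurd h ht
  filter_upwards [Filter.eventually_all.mpr fun S => Filter.eventually_all.mpr (h S)] with t ht S
  exact ht S _ rfl

lemma one_le_ncard_recurrentOrd {n : ℕ} (α : Fin n → ℝ) (S : Finset (Fin n)) :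
    1 ≤ (recurrentOrd α S).ncard := by
  obtain ⟨t, ht⟩ := (eventually_mem_recurrentOrd α).exists
  exact (Set.ncard_pos (Set.toFinite _)).mpr ⟨_, ht S⟩

lemma ncard_recurrentOrd_lt {n : ℕ} {α : Fin n → ℝ} {S S' : Finset (Fin n)} (hS : S' ⊆ S)
    {s t : ℕ} (hs : ordRel α S s ∈ recurrentOrd α S) (ht : ordRel α S t ∈ recurrentOrd α S)
    (hne : ordRel α S s ≠ ordRel α S t) (heq : ordRel α S' s = ordRel α S' t) :
    (recurrentOrd α S').ncard + 1 ≤ (recurrentOrd α S).ncard := by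
  let r : (Fin n → Fin n → Prop) → Fin n → Fin n → Prop := fun R i j => i ∈ S' ∧ j ∈ S' ∧ R i j
  have hr : ∀ u, ordRel α S' u = r (ordRel α S u) := by
    intro u
    funext i j
    refine propext ⟨fun h => ⟨h.1, h.2.1, hS h.1, hS h.2.1, h.2.2⟩,
      fun h => ⟨h.1, h.2.1, h.2.2.2.2⟩⟩
  have hsub : recurrentOrd α S' ⊆ r '' (recurrentOrd α S \ {ordRel α S s}) := by
    intro R hR
    obtain ⟨u, hu, hu'⟩ :=
      (Filter.Frequently.and_eventually hR (eventually_mem_recurrentOrd α)).exists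
    by_cases h : ordRel α S u = ordRel α S s
    · refine ⟨ordRel α S t, ⟨ht, fun h' => hne h'.symm⟩, ?_⟩
      rw [← hr, ← heq, hr, ← h, ← hr, hu]
    · exact ⟨ordRel α S u, ⟨hu' S, h⟩, by rw [← hr, hu]⟩
  have h1 := Set.ncard_le_ncard hsub (Set.toFinite _)
  have h2 := Set.ncard_image_le (f := r) (Set.toFinite (recurrentOrd α S \ {ordRel α S s}))
  have h3 := Set.ncard_sdiff_singleton_add_one hs (Set.toFinite _)
  omega

lemma eventually_le_of_consec {α : ℝ} (hα : Irrational α) (M : ℕ) :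
    ∀ᶠ t in Filter.atTop, ∀ y, Consec α y t → M ≤ y := by
  obtain ⟨q, hq, hb⟩ := exists_isBest_gt hα M
  filter_upwards [Filter.eventually_gt_atTop q] with t ht y hy
  exact hq.le.trans (hy.le_left hb ht)

/-- Simultaneous jumps give rise to as many recurrent orders. -/
lemma eventually_card_le_ncard {n : ℕ} {α : Fin n → ℝ} (hirr : ∀ i, Irrational (α i)) {N : ℕ}
    (hne : ∀ i j, i ≠ j → ∀ m : ℕ, N ≤ m → psi (α i) m ≠ psi (α j) m) :
    ∀ᶠ t in Filter.atTop, ∀ S J : Finset (Fin n), J ⊆ S → (∀ i ∈ J, IsBest (α i) t) →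
      J.card ≤ (recurrentOrd α S).ncard := by
  obtain ⟨T₀, hT₀⟩ := Filter.eventually_atTop.mp (eventually_mem_recurrentOrd α)
  have hcons : ∀ i j, ∃ M : ℕ, i ≠ j → ∀ q q', M ≤ q → Consec (α i) q q' →
      ¬ Consec (α j) q q' := by
    intro i j
    by_cases hij : i = j
    · exact ⟨0, fun h => absurd hij h⟩
    · obtain ⟨M, hM⟩ := eventually_not_consec (hirr i) (hirr j) (hne i j hij)
      exact ⟨M, fun _ => hM⟩
  choose M hM using hcons
  filter_upwards [Filter.eventually_all.mpr fun i => eventually_le_of_consec (hirr i) (T₀ + 2),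
    Filter.eventually_all.mpr fun i => Filter.eventually_all.mpr fun j =>
      eventually_le_of_consec (hirr i) (M i j),
    Filter.eventually_gt_atTop (T₀ + N + 2)] with t ht₀ htM htN S J hJS hJ
  rcases J.eq_empty_or_nonempty with rfl | hJne
  · simp
  obtain ⟨top, htop, hmax⟩ := J.exists_max_image (fun i => psi (α i) ((t - 1 : ℕ) : ℝ)) hJne
  have hex : ∀ i ∈ J, ∃ y, Consec (α i) y t := fun i hi =>
    exists_consec_left (hirr i) (hJ i hi) (by omega)
  choose! y hy using hex
  have hy1 : ∀ i ∈ J, T₀ + 2 ≤ y i := fun i hi => ht₀ i _ (hy i hi)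
  have hyt : ∀ i ∈ J, y i < t := fun i hi => (hy i hi).2.2.1
  have hyinj : ∀ i ∈ J, ∀ j ∈ J, i ≠ j → y i ≠ y j := by
    intro i hi j hj hij h
    have h1 := hy j hj
    rw [← h] at h1
    exact hM i j hij _ _ (htM i j _ (hy i hi)) (hy i hi) h1
  have hbefore : ∀ i ∈ J, ∀ m, y i ≤ m → m < t → psi (α i) m = nd (α i) (y i) :=
    fun i hi m h1 h2 => (hy i hi).psi_eq h1 h2
  have hlast : ∀ i ∈ J, psi (α i) ((t - 1 : ℕ) : ℝ) = nd (α i) (y i) :=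
    fun i hi => hbefore i hi _ (by have := hyt i hi; omega) (by omega)
  have hlt : ∀ i ∈ J, i ≠ top → nd (α i) (y i) < nd (α top) (y top) := by
    intro i hi hit
    rw [← hlast i hi, ← hlast top htop]
    exact lt_of_le_of_ne (hmax i hi) (hne i top hit _ (by omega))
  have hbelow : ∀ i ∈ J, i ≠ top → ∀ m, y i ≤ m → m < t → psi (α i) m < psi (α top) m := by
    intro i hi hit m h1 h2
    rw [hbefore i hi m h1 h2]
    refine (hlt i hi hit).trans_le ?_
    rw [← hlast top htop]
    have := hy1 i hi
    exact psi_le_psi _ (by exact_mod_cast (by omega : 1 ≤ m))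
      (by exact_mod_cast (by omega : m ≤ t - 1))
  have habove : ∀ i ∈ J, i ≠ top →
      psi (α top) ((y i - 1 : ℕ) : ℝ) < psi (α i) ((y i - 1 : ℕ) : ℝ) := fun i hi hit =>
    psi_lt_psi_before_jump (hirr i) (hirr top) (by have := hy1 i hi; omega) (hy i hi)
      (hy top htop) (hlt i hi hit) (hyinj i hi top htop hit)
  let s : Fin n → ℕ := fun i => if i = top then t else y i
  have hs : ∀ i ∈ J, T₀ + 2 ≤ s i ∧ s i ≤ t := by
    intro i hi
    by_cases h : i = top
    · simp only [s, if_pos h]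
      omega
    · simp only [s, if_neg h]
      exact ⟨hy1 i hi, (hyt i hi).le⟩
  have hsep : ∀ i ∈ J, ∀ j ∈ J, s i < s j → ordRel α S (s i - 1) ≠ ordRel α S (s j - 1) := by
    intro i hi j hj hij h
    have hit : i ≠ top := by
      rintro rfl
      simp only [s, if_true] at hij
      have := (hs j hj).2
      simp only [s] at this
      omega
    have hsi : s i = y i := by simp only [s, if_neg hit]
    rw [hsi] at hij h
    have h1 : ordRel α S (s j - 1) i top :=
      ⟨hJS hi, hJS htop, hbelow i hi hit _ (by omega) (by have := (hs j hj).2; omega)⟩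
    rw [← h] at h1
    exact lt_asymm h1.2.2 (habove i hi hit)
  have hsinj : ∀ i ∈ J, ∀ j ∈ J, i ≠ j → s i ≠ s j := by
    intro i hi j hj hij
    have h1 := hyt i hi
    have h2 := hyt j hj
    have h3 := hyinj i hi j hj hij
    simp only [s]
    split_ifs with h4 h5 h5
    · exact absurd (h4.trans h5.symm) hij
    all_goals omega
  rw [← Set.ncard_coe_finset]
  refine Set.ncard_le_ncard_of_injOn (fun i => ordRel α S (s i - 1))
    (fun i hi => hT₀ _ (by have := (hs i hi).1; omega) S) ?_ (Set.toFinite _)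
  intro i hi j hj h
  by_contra hij
  rcases (hsinj i hi j hj hij).lt_or_gt with h1 | h1
  · exact hsep i hi j hj h1 h
  · exact hsep j hj i hi h1 h.symm

open Classical in
/-- The functions that jump at time `t`. -/
noncomputable def jumpSet {n : ℕ} (α : Fin n → ℝ) (S : Finset (Fin n)) (t : ℕ) :
    Finset (Fin n) := S.filter fun i => IsBest (α i) t

lemma mem_jumpSet {n : ℕ} {α : Fin n → ℝ} {S : Finset (Fin n)} {t : ℕ} {i : Fin n} :
    i ∈ jumpSet α S t ↔ i ∈ S ∧ IsBest (α i) t := by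
  simp [jumpSet]

lemma jumpSet_subset {n : ℕ} (α : Fin n → ℝ) (S : Finset (Fin n)) (t : ℕ) :
    jumpSet α S t ⊆ S :=
  fun _ hi => (mem_jumpSet.mp hi).1

lemma ordRel_sdiff_jumpSet {n : ℕ} {α : Fin n → ℝ} (hirr : ∀ i, Irrational (α i))
    (S : Finset (Fin n)) {t : ℕ} (ht : 1 < t) :
    ordRel α (S \ jumpSet α S t) (t - 1) = ordRel α (S \ jumpSet α S t) t := by
  have h : ∀ i ∈ S \ jumpSet α S t, psi (α i) ((t - 1 : ℕ) : ℝ) = psi (α i) t := by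
    intro i hi
    simp only [Finset.mem_sdiff, mem_jumpSet, not_and] at hi
    exact psi_pred_eq (hirr i) ht (hi.2 hi.1)
  funext i j
  refine propext (and_congr_right fun hi => and_congr_right fun hj => ?_)
  rw [h i hi, h j hj]

/-- At a change of order, the functions that do not jump have fewer recurrent orders. -/
lemma eventually_ncard_sdiff_jumpSet_lt {n : ℕ} {α : Fin n → ℝ}
    (hirr : ∀ i, Irrational (α i)) :
    ∀ᶠ t in Filter.atTop, ∀ S : Finset (Fin n), ordRel α S (t - 1) ≠ ordRel α S t →
      (recurrentOrd α (S \ jumpSet α S t)).ncard + 1 ≤ (recurrentOrd α S).ncard := by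
  obtain ⟨T₀, hT₀⟩ := Filter.eventually_atTop.mp (eventually_mem_recurrentOrd α)
  filter_upwards [Filter.eventually_gt_atTop (T₀ + 1)] with t ht S hS
  exact ncard_recurrentOrd_lt Finset.sdiff_subset (hT₀ _ (by omega) S) (hT₀ _ (by omega) S) hS
    (ordRel_sdiff_jumpSet hirr S (by omega))

lemma exists_ordRel_ne {n : ℕ} {α : Fin n → ℝ} (hirr : ∀ i, Irrational (α i)) {N : ℕ}
    (hne : ∀ i j, i ≠ j → ∀ m : ℕ, N ≤ m → psi (α i) m ≠ psi (α j) m) {S : Finset (Fin n)}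
    (hS : 1 < S.card) (T : ℕ) : ∃ t, T < t ∧ ordRel α S (t - 1) ≠ ordRel α S t := by
  obtain ⟨i, hi, j, hj, hij⟩ := Finset.one_lt_card.mp hS
  obtain ⟨m, hm, h1⟩ := exists_psi_lt (hirr i) (hirr j) (hne i j hij) T
  obtain ⟨m', hm', h2⟩ := exists_psi_lt (hirr j) (hirr i) (hne j i hij.symm) m
  by_contra! hcon
  have h3 : ∀ u, m ≤ u → ordRel α S m = ordRel α S u := by
    intro u hu
    induction u, hu using Nat.le_induction with
    | base => rfl
    | succ u hu ih => exact ih.trans (hcon (u + 1) (by omega))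
  have h4 : ordRel α S m i j := ⟨hi, hj, h1⟩
  rw [h3 m' hm'] at h4
  exact lt_asymm h4.2.2 h2

/-- The number of functions is bounded in terms of the number of recurrent orders. -/
lemma two_mul_card_le {n : ℕ} {α : Fin n → ℝ} (hirr : ∀ i, Irrational (α i)) {N : ℕ}
    (hne : ∀ i j, i ≠ j → ∀ m : ℕ, N ≤ m → psi (α i) m ≠ psi (α j) m) (S : Finset (Fin n)) :
    2 * S.card ≤ (recurrentOrd α S).ncard * ((recurrentOrd α S).ncard + 1) := by
  induction S using Finset.strongInduction with
  | H S ih =>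
    have hK := one_le_ncard_recurrentOrd α S
    rcases Nat.lt_or_ge 1 S.card with hS | hS
    · obtain ⟨T, hT⟩ := Filter.eventually_atTop.mp ((eventually_card_le_ncard hirr hne).and
        (eventually_ncard_sdiff_jumpSet_lt hirr))
      obtain ⟨t, ht, hch⟩ := exists_ordRel_ne hirr hne hS (T + 1)
      obtain ⟨h1, h2⟩ := hT t (by omega)
      have hJS := jumpSet_subset α S t
      have hJ := h1 S (jumpSet α S t) hJS fun i hi => (mem_jumpSet.mp hi).2
      have hlt := h2 S hch
      have hss : S \ jumpSet α S t ⊂ S := by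
        refine Finset.sdiff_ssubset hJS (Finset.nonempty_iff_ne_empty.mpr fun h0 => hch ?_)
        have := ordRel_sdiff_jumpSet hirr S (t := t) (by omega)
        rwa [h0, Finset.sdiff_empty] at this
      have hih := ih _ hss
      have hcard := Finset.card_sdiff_add_card_eq_card hJS
      nlinarith
    · nlinarith

lemma eventually_card_jumpSet {n k : ℕ} {α : Fin n → ℝ} (hirr : ∀ i, Irrational (α i)) {N : ℕ}
    (hne : ∀ i j, i ≠ j → ∀ m : ℕ, N ≤ m → psi (α i) m ≠ psi (α j) m)
    (hn : n = k * (k + 1) / 2) (hk : (recurrentOrd α Finset.univ).ncard = k) :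
    ∀ᶠ t in Filter.atTop, ordRel α Finset.univ (t - 1) ≠ ordRel α Finset.univ t →
      (jumpSet α Finset.univ t).card = k := by
  filter_upwards [eventually_card_le_ncard hirr hne, eventually_ncard_sdiff_jumpSet_lt hirr]
    with t h1 h2 hch
  have hJ := h1 Finset.univ _ (Finset.subset_univ (jumpSet α Finset.univ t))
    fun i hi => (mem_jumpSet.mp hi).2
  have hlt := h2 _ hch
  have hle := two_mul_card_le hirr hne (Finset.univ \ jumpSet α Finset.univ t)
  have hcard := Finset.card_sdiff_add_card_eq_card
    (Finset.subset_univ (jumpSet α Finset.univ t))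
  rw [Finset.card_univ, Fintype.card_fin] at hcard
  have hn2 : 2 * n = k * (k + 1) := by
    rw [hn]
    exact Nat.mul_div_cancel' (Nat.even_mul_succ_self k).two_dvd
  rw [hk] at hJ hlt
  nlinarith

/-- The relative order encoded by an order vector. -/
def relOfVec {n : ℕ} (v : Fin n → Fin n) : Fin n → Fin n → Prop :=
  fun i j => ∃ p q, p < q ∧ v p = j ∧ v q = i

lemma IsOrderVec.ordRel_eq {n : ℕ} {α : Fin n → ℝ} {t : ℕ} {v : Fin n → Fin n}
    (h : IsOrderVec α t v) : ordRel α Finset.univ t = relOfVec v := by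
  funext i j
  refine propext ⟨fun hij => ?_, ?_⟩
  · obtain ⟨q, rfl⟩ := h.1.2 i
    obtain ⟨p, rfl⟩ := h.1.2 j
    refine ⟨p, q, ?_, rfl, rfl⟩
    rcases lt_trichotomy p q with h1 | rfl | h1
    · exact h1
    · exact absurd hij.2.2 (lt_irrefl _)
    · exact absurd hij.2.2 (lt_asymm (h.2 q p h1))
  · rintro ⟨p, q, hpq, rfl, rfl⟩
    exact ⟨Finset.mem_univ _, Finset.mem_univ _, h.2 p q hpq⟩

lemma isOrderVec_of_ordRel_eq {n : ℕ} {α : Fin n → ℝ} {t : ℕ} {v : Fin n → Fin n}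
    (hv : Function.Bijective v) (h : ordRel α Finset.univ t = relOfVec v) :
    IsOrderVec α t v := by
  refine ⟨hv, fun p q hpq => ?_⟩
  have h1 : relOfVec v (v q) (v p) := ⟨p, q, hpq, rfl, rfl⟩
  rw [← h] at h1
  exact h1.2.2

lemma exists_isOrderVec {n : ℕ} {α : Fin n → ℝ} {t : ℝ}
    (hne : ∀ i j, i ≠ j → psi (α i) t ≠ psi (α j) t) : ∃ v, IsOrderVec α t v := by
  let f : Fin n → ℝ := fun i => -psi (α i) t
  refine ⟨Tuple.sort f, (Tuple.sort f).bijective, fun p q hpq => lt_of_le_of_ne ?_ ?_⟩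
  · exact neg_le_neg_iff.mp (Tuple.monotone_sort f hpq.le)
  · exact hne _ _ fun h => hpq.ne' ((Tuple.sort f).injective h)

lemma IsOrderVec.unique {n : ℕ} {α : Fin n → ℝ} {t : ℝ} {v w : Fin n → Fin n}
    (hne : ∀ i j, i ≠ j → psi (α i) t ≠ psi (α j) t) (hv : IsOrderVec α t v)
    (hw : IsOrderVec α t w) : v = w := by
  let f : Fin n → ℝ := fun i => -psi (α i) t
  have hf : Function.Injective f := fun i j h => by
    by_contra hij
    exact hne i j hij (neg_injective h)
  have h1 : StrictMono (f ∘ v) := fun p q hpq => neg_lt_neg (hv.2 p q hpq)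
  have h2 : StrictMono (f ∘ w) := fun p q hpq => neg_lt_neg (hw.2 p q hpq)
  have h3 : f ∘ v = f ∘ w := by
    rw [← h1.range_inj h2, hv.1.2.range_comp, hw.1.2.range_comp]
  exact hf.comp_left h3

lemma isOrderVec_floor {n : ℕ} {α : Fin n → ℝ} {t : ℝ} (ht : 0 ≤ t) {v : Fin n → Fin n} :
    IsOrderVec α (⌊t⌋₊ : ℝ) v ↔ IsOrderVec α t v := by
  simp only [IsOrderVec, psi_floor _ ht]

lemma occursInfinitely_iff {n : ℕ} {α : Fin n → ℝ} {v : Fin n → Fin n} :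
    OccursInfinitely α v ↔ ∃ᶠ t : ℕ in Filter.atTop, IsOrderVec α t v := by
  rw [Filter.frequently_atTop]
  constructor
  · intro h T
    obtain ⟨t, ht, hv⟩ := h T
    have ht0 : 0 ≤ t := T.cast_nonneg.trans ht.le
    exact ⟨⌊t⌋₊, Nat.le_floor ht.le, (isOrderVec_floor ht0).mpr hv⟩
  · intro h T
    obtain ⟨t, ht, hv⟩ := h (⌊T⌋₊ + 1)
    exact ⟨t, (Nat.lt_floor_add_one T).trans_le (by exact_mod_cast ht), hv⟩

lemma kAlpha_eq_ncard_recurrentOrd {n : ℕ} {α : Fin n → ℝ} {N : ℕ}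
    (hne : ∀ i j, i ≠ j → ∀ m : ℕ, N ≤ m → psi (α i) m ≠ psi (α j) m) :
    kAlpha α = (recurrentOrd α Finset.univ).ncard := by
  have himage : recurrentOrd α Finset.univ = relOfVec '' {v | OccursInfinitely α v} := by
    ext R
    constructor
    · intro hR
      obtain ⟨t, ht, htN⟩ :=
        (Filter.Frequently.and_eventually hR (Filter.eventually_ge_atTop N)).exists
      obtain ⟨v, hv⟩ := exists_isOrderVec fun i j hij => hne i j hij t htN
      have hvR : relOfVec v = R := hv.ordRel_eq.symm.trans ht
      exact ⟨v, occursInfinitely_iff.mpr (Filter.Frequently.mono hR fun s hs =>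
        isOrderVec_of_ordRel_eq hv.1 (hs.trans hvR.symm)), hvR⟩
    · rintro ⟨v, hv, rfl⟩
      exact (occursInfinitely_iff.mp hv).mono fun t ht => ht.ordRel_eq
  have hinj : Set.InjOn relOfVec {v | OccursInfinitely α v} := by
    intro v hv w hw h
    obtain ⟨t, ht, htN⟩ := ((occursInfinitely_iff.mp hv).and_eventually
      (Filter.eventually_ge_atTop N)).exists
    obtain ⟨s, hs⟩ := (occursInfinitely_iff.mp hw).exists
    exact ht.unique (fun i j hij => hne i j hij t htN)
      (isOrderVec_of_ordRel_eq hs.1 (ht.ordRel_eq.trans h))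
  rw [himage, hinj.ncard_image]
  exact Nat.card_coe_set_eq _

lemma sameOrder_iff {n : ℕ} {α : Fin n → ℝ} {s t : ℝ} (hs : 0 ≤ s) (ht : 0 ≤ t) :
    SameOrder α s t ↔ ordRel α Finset.univ ⌊s⌋₊ = ordRel α Finset.univ ⌊t⌋₊ := by
  simp only [SameOrder, ordRel, Finset.mem_univ, true_and, psi_floor _ hs, psi_floor _ ht,
    funext_iff, eq_iff_iff]

/-- The moments of change are integers. -/
lemma exists_nat_of_isLeast {n : ℕ} {α : Fin n → ℝ} {s t : ℝ} (hs : 0 ≤ s)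
    (h : IsLeast {t : ℝ | s < t ∧ ¬ SameOrder α s t} t) :
    ∃ m : ℕ, t = m ∧ ordRel α Finset.univ (m - 1) ≠ ordRel α Finset.univ m := by
  obtain ⟨⟨hst, hch⟩, hmin⟩ := h
  have ht : 0 ≤ t := hs.trans hst.le
  rw [sameOrder_iff hs ht] at hch
  have hlt : ⌊s⌋₊ < ⌊t⌋₊ :=
    (Nat.floor_mono hst.le).lt_of_ne fun h => hch (congrArg _ h)
  have hsame : ∀ m : ℕ, ⌊s⌋₊ < m → (m : ℝ) < t →
      ordRel α Finset.univ ⌊s⌋₊ = ordRel α Finset.univ m := by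
    intro m h1 h2
    by_contra h3
    refine absurd (hmin ⟨(Nat.floor_lt hs).mp h1, ?_⟩) (not_le.mpr h2)
    rwa [sameOrder_iff hs m.cast_nonneg, Nat.floor_natCast]
  have hfl : t = (⌊t⌋₊ : ℝ) := by
    by_contra h
    exact hch (hsame _ hlt ((Nat.floor_le ht).lt_of_ne fun h' => h h'.symm))
  refine ⟨⌊t⌋₊, hfl, fun h => hch ?_⟩
  rw [← h]
  rcases (Nat.le_sub_one_of_lt hlt).eq_or_lt with h1 | h1
  · rw [← h1]
  · refine hsame _ h1 ?_
    have h2 : ((⌊t⌋₊ - 1 : ℕ) : ℝ) < (⌊t⌋₊ : ℝ) := Nat.cast_lt.mpr (by omega)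
    exact h2.trans_le hfl.ge

lemma not_continuousAt_psi_iff {α : ℝ} (hα : Irrational α) {m : ℕ} (hm : 1 < m) :
    ¬ ContinuousAt (psi α) m ↔ IsBest α m := by
  have hcast : ((m - 1 : ℕ) : ℝ) + 1 = m := by
    exact_mod_cast (by omega : m - 1 + 1 = m)
  have hpred : ∀ x : ℝ, ((m - 1 : ℕ) : ℝ) < x → x < m → psi α x = psi α ((m - 1 : ℕ) : ℝ) := by
    intro x h1 h2
    have hx : 0 ≤ x := (Nat.cast_nonneg _).trans h1.le
    rw [← psi_floor α hx, (Nat.floor_eq_iff hx).mpr ⟨h1.le, by rwa [hcast]⟩]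
  have hlt : ((m - 1 : ℕ) : ℝ) < m := by linarith
  rw [not_iff_comm]
  constructor
  · intro hb
    have hev : ∀ᶠ x in nhds (m : ℝ), psi α m = psi α x := by
      filter_upwards [Ioo_mem_nhds hlt (lt_add_one (m : ℝ))] with x hx
      rcases lt_or_ge x m with h | h
      · rw [hpred x hx.1 h, psi_pred_eq hα hm hb]
      · have hx0 : 0 ≤ x := m.cast_nonneg.trans h
        rw [← psi_floor α hx0, (Nat.floor_eq_iff hx0).mpr ⟨h, hx.2⟩]
    exact continuousAt_const.congr hev
  · intro hc hb
    have h1 : Filter.Tendsto (psi α) (nhdsWithin (m : ℝ) (Set.Iio m)) (nhds (psi α m)) :=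
      hc.tendsto.mono_left nhdsWithin_le_nhds
    have h2 : Filter.Tendsto (psi α) (nhdsWithin (m : ℝ) (Set.Iio m))
        (nhds (psi α ((m - 1 : ℕ) : ℝ))) := by
      refine tendsto_const_nhds.congr' ?_
      filter_upwards [Ioo_mem_nhdsLT hlt] with x hx
      exact (hpred x hx.1 hx.2).symm
    exact (psi_lt_psi_pred hα hm hb).ne (tendsto_nhds_unique h1 h2)

/-- **Theorem (Main), item (i).** At every moment of permutation change, exactly `k`
functions have a jump. -/
theorem stmt10 (k : ℕ) (hk : 2 ≤ k) (n : ℕ) (hn : n = k * (k + 1) / 2)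
    (α : Fin n → ℝ) (hirr : ∀ i, Irrational (α i)) (hind : PairwiseIndependent α)
    (hka : kAlpha α = k) :
    ∃ T : ℝ, 1 < T ∧ ∀ t0 : ℝ, T ≤ t0 → ∀ ts : ℕ → ℝ, ts 0 = t0 → IsChangeSeq α ts →
      ∀ i : ℕ, 1 ≤ i →
        Nat.card {j : Fin n // ¬ ContinuousAt (psi (α j)) (ts i)} = k := by
  obtain ⟨T₀, -, hT₀⟩ := hind
  have hne : ∀ i j, i ≠ j → ∀ m : ℕ, ⌈T₀⌉₊ ≤ m → psi (α i) m ≠ psi (α j) m :=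
    fun i j hij m hm => hT₀ m (Nat.ceil_le.mp hm) i j hij
  obtain ⟨M, hM⟩ := Filter.eventually_atTop.mp (eventually_card_jumpSet hirr hne hn
    ((kAlpha_eq_ncard_recurrentOrd hne).symm.trans hka))
  refine ⟨(M + 2 : ℕ), by exact_mod_cast (by omega : 1 < M + 2), ?_⟩
  intro t₀ ht₀ ts hts hseq i hi
  obtain ⟨i, rfl⟩ := Nat.exists_eq_add_of_le' hi
  have hge : ((M + 2 : ℕ) : ℝ) ≤ ts i :=
    (hts ▸ ht₀).trans ((strictMono_nat_of_lt_succ fun j => (hseq j).1.1).monotone i.zero_le)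
  obtain ⟨m, hm, hch⟩ := exists_nat_of_isLeast ((Nat.cast_nonneg _).trans hge) (hseq i)
  have hMm : M + 2 < m := by exact_mod_cast hge.trans_lt (hm ▸ (hseq i).1.1)
  rw [← hM m (by omega) hch, hm]
  refine Nat.subtype_card _ fun j => ?_
  rw [mem_jumpSet, not_continuousAt_psi_iff (hirr j) (by omega)]
  simp
end
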